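/- arXiv:1905.06793 — 2 statements merged into one kernel-verified Lean document; each statement's English description precedes it below -/
import Mathlib

section
/- Let μ be a nonzero finite Borel measure on ℝ with compact support, and let 0 < α ≤ 1, 0 < β ≤ 1 and C₀, C₁ > 0 be such that μ([x-r, x+r]) ≤ C₀ r^α for all x ∈ ℝ and r > 0, and |∫_ℝ e^{-i ξ t} dμ(t)| ≤ C₁ (1+|ξ|)^{-β/2} for all ξ ∈ ℝ. Then for every p with 1 ≤ p < 2(2-2α+β)/(4(1-α)+β) there exists a constant A > 0 such that (∫_ℝ |𝓕f(ξ)|² dμ(ξ))^{1/2} ≤ A ‖f‖_{L^p(ℝ)} for every Schwartz function f : ℝ → ℂ. -/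
open MeasureTheory Complex Real

open scoped ENNReal FourierTransform

/-- The Fourier transform with the normalization `∫ f(x) e^{-ixξ} dx`. -/
noncomputable def angularFourier (f : ℝ → ℂ) (ξ : ℝ) : ℂ :=
  ∫ x, f x * Complex.exp (-(Complex.I * x * ξ))

lemma norm_exp_neg_I_mul (x ξ : ℝ) : ‖Complex.exp (-(Complex.I * x * ξ))‖ = 1 := by
  rw [show -(Complex.I * x * ξ) = ((-(x * ξ) : ℝ) : ℂ) * Complex.I by push_cast; ring,
    Complex.norm_exp_ofReal_mul_I]

lemma continuous_angularFourier {f : ℝ → ℂ} (hf : Integrable f) :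
    Continuous (angularFourier f) := by
  refine continuous_of_dominated (bound := fun x => ‖f x‖) ?_ ?_ hf.norm ?_
  · intro ξ
    exact hf.1.mul (by fun_prop)
  · intro ξ
    filter_upwards with x
    rw [norm_mul, norm_exp_neg_I_mul, mul_one]
  · filter_upwards with x
    fun_prop

lemma norm_angularFourier_le (f : ℝ → ℂ) (ξ : ℝ) :
    ‖angularFourier f ξ‖ ≤ ∫ x, ‖f x‖ := by
  refine (norm_integral_le_integral_norm _).trans_eq ?_
  simp_rw [norm_mul, norm_exp_neg_I_mul, mul_one]

lemma integrable_mul_exp_neg_I_mul {f : ℝ → ℂ} (hf : Integrable f) (ξ : ℝ) :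
    Integrable fun x : ℝ => f x * Complex.exp (-(Complex.I * x * ξ)) := by
  refine hf.mono (hf.1.mul (by fun_prop)) ?_
  filter_upwards with x
  rw [norm_mul, norm_exp_neg_I_mul, mul_one]

lemma angularFourier_add {f g : ℝ → ℂ} (hf : Integrable f) (hg : Integrable g) :
    angularFourier (f + g) = angularFourier f + angularFourier g := by
  ext ξ
  simp only [angularFourier, Pi.add_apply, add_mul]
  exact integral_add (integrable_mul_exp_neg_I_mul hf ξ) (integrable_mul_exp_neg_I_mul hg ξ)

lemma angularFourier_const_mul (c : ℂ) (f : ℝ → ℂ) (ξ : ℝ) :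
    angularFourier (fun x => c * f x) ξ = c * angularFourier f ξ := by
  simp only [angularFourier, mul_assoc]
  exact integral_const_mul c _

lemma angularFourier_eq_fourier (f : ℝ → ℂ) (ξ : ℝ) :
    angularFourier f ξ = 𝓕 f ((2 * π)⁻¹ * ξ) := by
  rw [Real.fourier_eq', angularFourier]
  congr 1
  ext x
  rw [smul_eq_mul, mul_comm]
  congr 2
  simp only [RCLike.inner_apply, conj_trivial]
  push_cast
  field_simp [Complex.ofReal_ne_zero.mpr Real.pi_ne_zero]

/-- On `L¹ ∩ L²`, the `L²` Fourier transform is given by the Fourier integral. -/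
lemma coeFn_fourier_toLp {g : ℝ → ℂ} (hg : Integrable g) (hg2 : MemLp g 2) :
    (𝓕 (hg2.toLp g) : Lp ℂ 2 (volume : Measure ℝ)) =ᵐ[volume] 𝓕 g := by
  refine ae_eq_of_integral_contDiff_smul_eq ?_ ?_ ?_
  · exact (Lp.memLp _).locallyIntegrable (by norm_num)
  · exact (VectorFourier.fourierIntegral_continuous Real.continuous_fourierChar
      (by fun_prop : Continuous fun p : ℝ × ℝ => innerₗ ℝ p.1 p.2) hg).locallyIntegrable
  intro φ hφ hφc
  have h1 : HasCompactSupport (fun x => (φ x : ℂ)) := hφc.comp_left (g := fun x : ℝ => (x : ℂ)) rfl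
  have h2 : ContDiff ℝ (⊤ : ℕ∞) (fun x => (φ x : ℂ)) := Complex.ofRealCLM.contDiff.comp hφ
  set Φ : SchwartzMap ℝ ℂ := h1.toSchwartzMap h2
  have hΦ : ∀ x, Φ x = (φ x : ℂ) := fun x => rfl
  have h3 := congrArg (fun T => T Φ) (Lp.fourier_toTemperedDistribution_eq (hg2.toLp g))
  simp only [TemperedDistribution.fourier_apply, Lp.toTemperedDistribution_apply] at h3
  have h4 : ∫ x, φ x • (𝓕 (hg2.toLp g) : Lp ℂ 2 (volume : Measure ℝ)) x
      = ∫ x, Φ x • (𝓕 (hg2.toLp g) : Lp ℂ 2 (volume : Measure ℝ)) x := by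
    simp [hΦ]
  rw [h4, ← h3]
  have h5 : ∫ x, φ x • 𝓕 g x = ∫ x, Φ x • 𝓕 g x := by simp [hΦ]
  rw [h5]
  have h6 : ∫ x, (𝓕 Φ) x • (hg2.toLp g) x = ∫ x, (𝓕 (Φ : ℝ → ℂ)) x • g x := by
    refine integral_congr_ae ?_
    filter_upwards [hg2.coeFn_toLp] with x hx
    rw [hx, SchwartzMap.fourier_coe]
  rw [h6]
  have := VectorFourier.integral_fourierIntegral_smul_eq_flip (L := innerₗ ℝ)
      Real.continuous_fourierChar continuous_inner Φ.integrable hg (μ := volume) (ν := volume)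
  rw [flip_innerₗ] at this
  exact this

lemma eLpNorm_two_sq {μ : Measure ℝ} (h : ℝ → ℂ) :
    eLpNorm h 2 μ ^ 2 = ∫⁻ x, ‖h x‖ₑ ^ 2 ∂μ := by
  simpa using eLpNorm_nnreal_pow_eq_lintegral (f := h) (p := 2) (μ := μ) (by norm_num)

/-- Plancherel's theorem on `L¹ ∩ L²`. -/
lemma lintegral_enorm_sq_angularFourier {g : ℝ → ℂ} (hg : Integrable g) (hg2 : MemLp g 2) :
    ∫⁻ ξ, ‖angularFourier g ξ‖ₑ ^ 2 = ENNReal.ofReal (2 * π * ∫ x, ‖g x‖ ^ 2) := by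
  have h1 : eLpNorm (𝓕 g) 2 volume = eLpNorm g 2 volume := by
    rw [← eLpNorm_congr_ae (coeFn_fourier_toLp hg hg2), ← eLpNorm_congr_ae hg2.coeFn_toLp,
      ← Lp.enorm_def, ← Lp.enorm_def, ← ofReal_norm, ← ofReal_norm, Lp.norm_fourier_eq]
  simp_rw [angularFourier_eq_fourier]
  have hc : (2 * π)⁻¹ ≠ 0 := by positivity
  have hcont : Continuous (𝓕 g) :=
    VectorFourier.fourierIntegral_continuous Real.continuous_fourierChar
      (by fun_prop : Continuous fun p : ℝ × ℝ => innerₗ ℝ p.1 p.2) hg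
  have h3 : ∫⁻ ξ, ‖𝓕 g ((2 * π)⁻¹ * ξ)‖ₑ ^ 2
      = ∫⁻ y, ‖𝓕 g y‖ₑ ^ 2 ∂(Measure.map ((2 * π)⁻¹ * ·) volume) := by
    rw [lintegral_map (by fun_prop) (by fun_prop)]
  rw [h3, Real.map_volume_mul_left hc, lintegral_smul_measure, ← eLpNorm_two_sq, h1, eLpNorm_two_sq, inv_inv,
    abs_of_pos (by positivity), smul_eq_mul,
    ENNReal.ofReal_mul (show (0 : ℝ) ≤ 2 * π by positivity), ofReal_integral_eq_lintegral_ofReal]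
  · congr 2
    ext x
    rw [ENNReal.ofReal_pow (norm_nonneg _), ofReal_norm]
  · exact hg2.integrable_norm_pow (by norm_num)
  · filter_upwards with x
    positivity

section DecayingMeasure

variable {μ : Measure ℝ} [IsFiniteMeasure μ]

lemma continuous_exp_neg_I_mul : Continuous fun q : ℝ × ℝ × ℝ =>
    Complex.exp (-(Complex.I * q.1 * ((q.2.1 - q.2.2 : ℝ) : ℂ))) := by
  fun_prop

lemma integrable_kernel_mul_exp {K : ℝ × ℝ → ℂ} (hK : Integrable K) :
    Integrable (fun q : ℝ × ℝ × ℝ =>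
      K q.2 * Complex.exp (-(Complex.I * q.1 * ((q.2.1 - q.2.2 : ℝ) : ℂ))))
      (μ.prod volume) := by
  have h : Integrable (fun q : ℝ × ℝ × ℝ => K q.2) (μ.prod volume) := hK.comp_snd μ
  refine h.mono (h.1.mul continuous_exp_neg_I_mul.aestronglyMeasurable) ?_
  filter_upwards with q
  rw [norm_mul, norm_exp_neg_I_mul, mul_one]

lemma integral_integral_kernel_mul_exp {K : ℝ × ℝ → ℂ} (hK : Integrable K) :
    ∫ ξ : ℝ, (∫ z : ℝ × ℝ, K z * Complex.exp (-(Complex.I * ξ * ((z.1 - z.2 : ℝ) : ℂ)))) ∂μ =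
      ∫ z : ℝ × ℝ, K z * ∫ ξ : ℝ, Complex.exp (-(Complex.I * ((z.1 - z.2 : ℝ) : ℂ) * ξ)) ∂μ := by
  rw [integral_integral_swap (integrable_kernel_mul_exp hK)]
  congr 1
  ext z
  rw [← integral_const_mul]
  congr 1
  ext ξ
  congr 3
  ring

lemma normSq_angularFourier_eq (g : ℝ → ℂ) (ξ s : ℝ) :
    ((‖angularFourier g (ξ + s)‖ ^ 2 : ℝ) : ℂ) =
      ∫ z : ℝ × ℝ, (g z.1 * (starRingEnd ℂ) (g z.2) *
        Complex.exp (-(Complex.I * s * ((z.1 - z.2 : ℝ) : ℂ)))) *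
        Complex.exp (-(Complex.I * ξ * ((z.1 - z.2 : ℝ) : ℂ))) := by
  rw [Complex.ofReal_pow, ← Complex.mul_conj']
  simp only [angularFourier]
  rw [← integral_conj, Measure.volume_eq_prod, ← integral_prod_mul]
  congr 1
  ext z
  rw [map_mul, ← Complex.exp_conj, mul_mul_mul_comm, mul_assoc (_ * _), ← Complex.exp_add,
    ← Complex.exp_add]
  congr 2
  simp only [map_neg, map_mul, Complex.conj_I, Complex.conj_ofReal]
  push_cast
  ring

lemma min_two_le_two_mul_rpow {v γ : ℝ} (hv : 0 ≤ v) (hγ : 0 < γ) (hγ1 : γ ≤ 1) :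
    min 2 v ≤ 2 * v ^ γ := by
  rcases le_total v 1 with h | h
  · have := Real.rpow_le_rpow_of_exponent_ge' hv h hγ.le hγ1
    rw [Real.rpow_one] at this
    exact (min_le_right _ _).trans (by nlinarith)
  · have := Real.one_le_rpow h hγ.le
    exact (min_le_left _ _).trans (by linarith)

/-- If the Fourier transform of `μ` decays, then `∫ |𝓕 g|² dμ` changes little when `μ` is
translated by a small amount. -/
lemma integral_normSq_angularFourier_le_translate {β C₁ : ℝ} (hβ : 0 < β) (hβ1 : β ≤ 1)
    (hdecay : ∀ ξ : ℝ,
      ‖∫ t, Complex.exp (-(Complex.I * ξ * t)) ∂μ‖ ≤ C₁ * (1 + |ξ|) ^ (-(β / 2)))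
    {g : ℝ → ℂ} (hg : Integrable g) (s : ℝ) :
    ∫ ξ, ‖angularFourier g ξ‖ ^ 2 ∂μ ≤
      2 * C₁ * |s| ^ (β / 2) * (∫ x, ‖g x‖) ^ 2 +
        ∫ ξ, ‖angularFourier g (ξ + s)‖ ^ 2 ∂μ := by
  have hC₁ : 0 ≤ C₁ := by
    have := (norm_nonneg _).trans (hdecay 0)
    simpa using this
  set K : ℝ → ℝ × ℝ → ℂ := fun s z => g z.1 * (starRingEnd ℂ) (g z.2) *
    Complex.exp (-(Complex.I * s * ((z.1 - z.2 : ℝ) : ℂ))) with hKdef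
  have hbar : Integrable (fun y => (starRingEnd ℂ) (g y)) :=
    (Complex.conjCLE.toContinuousLinearMap.integrable_comp hg :)
  have hH : Integrable (fun z : ℝ × ℝ => g z.1 * (starRingEnd ℂ) (g z.2)) :=
    hg.mul_prod hbar
  have hK : ∀ s, Integrable (K s) := by
    intro s
    refine hH.mono (hH.1.mul (by fun_prop)) ?_
    filter_upwards with z
    rw [hKdef]
    rw [norm_mul _ (Complex.exp _), norm_exp_neg_I_mul, mul_one]
  have key : ∀ s : ℝ, ((∫ ξ, ‖angularFourier g (ξ + s)‖ ^ 2 ∂μ : ℝ) : ℂ) =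
      ∫ z, K s z * ∫ ξ, Complex.exp (-(Complex.I * ((z.1 - z.2 : ℝ) : ℂ) * ξ)) ∂μ := by
    intro s
    rw [← integral_integral_kernel_mul_exp (hK s), ← integral_complex_ofReal]
    congr 1
    ext ξ
    exact normSq_angularFourier_eq g ξ s
  have hKm : ∀ s, Integrable (fun z : ℝ × ℝ =>
      K s z * ∫ ξ, Complex.exp (-(Complex.I * ((z.1 - z.2 : ℝ) : ℂ) * ξ)) ∂μ) := by
    intro s
    have := (integrable_kernel_mul_exp (μ := μ) (hK s)).integral_prod_right
    refine this.congr (ae_of_all _ fun z => ?_)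
    simp only
    rw [← integral_const_mul]
    congr 1
    ext ξ
    congr 3
    ring
  have key0 := key 0
  simp only [add_zero] at key0
  have hdiff : ((∫ ξ, ‖angularFourier g ξ‖ ^ 2 ∂μ - ∫ ξ, ‖angularFourier g (ξ + s)‖ ^ 2 ∂μ : ℝ) : ℂ)
      = ∫ z, (K 0 z - K s z) *
          ∫ ξ, Complex.exp (-(Complex.I * ((z.1 - z.2 : ℝ) : ℂ) * ξ)) ∂μ := by
    rw [Complex.ofReal_sub, key0, key s, ← integral_sub (hKm 0) (hKm s)]
    simp only [sub_mul]
  have hbound : ‖∫ z, (K 0 z - K s z) *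
          ∫ ξ, Complex.exp (-(Complex.I * ((z.1 - z.2 : ℝ) : ℂ) * ξ)) ∂μ‖ ≤
      ∫ z : ℝ × ℝ, 2 * C₁ * |s| ^ (β / 2) * (‖g z.1‖ * ‖g z.2‖) := by
    refine norm_integral_le_of_norm_le ((hg.norm.mul_prod hg.norm).const_mul _) ?_
    filter_upwards with z
    set u := z.1 - z.2
    have e1 : K 0 z - K s z = g z.1 * (starRingEnd ℂ) (g z.2) *
        (1 - Complex.exp (Complex.I * ((-(s * u) : ℝ) : ℂ))) := by
      simp only [hKdef, mul_sub, Complex.ofReal_zero, mul_zero, zero_mul, neg_zero,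
        Complex.exp_zero, mul_one]
      congr 3
      rw [Complex.ofReal_neg, Complex.ofReal_mul]
      ring
    have e2 : ‖1 - Complex.exp (Complex.I * ((-(s * u) : ℝ) : ℂ))‖ ≤ min 2 (|s| * |u|) := by
      refine le_min ?_ ?_
      · refine (norm_sub_le _ _).trans ?_
        rw [Complex.norm_exp_I_mul_ofReal, norm_one]
        norm_num
      · rw [norm_sub_rev]
        refine Real.norm_exp_I_mul_ofReal_sub_one_le.trans ?_
        rw [Real.norm_eq_abs, abs_neg, abs_mul]
    have e3 := min_two_le_two_mul_rpow (v := |s| * |u|) (γ := β / 2) (by positivity) (by linarith)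
      (by linarith)
    rw [Real.mul_rpow (abs_nonneg _) (abs_nonneg _)] at e3
    have e4 : |u| ^ (β / 2) * (1 + |u|) ^ (-(β / 2)) ≤ 1 := by
      rw [Real.rpow_neg (by positivity), ← div_eq_mul_inv]
      refine div_le_one_of_le₀ ?_ (by positivity)
      exact Real.rpow_le_rpow (abs_nonneg _) (by linarith) (by linarith)
    rw [e1, norm_mul, norm_mul, norm_mul, RCLike.norm_conj]
    calc ‖g z.1‖ * ‖g z.2‖ * ‖1 - Complex.exp (Complex.I * ((-(s * u) : ℝ) : ℂ))‖ *
          ‖∫ ξ, Complex.exp (-(Complex.I * (u : ℂ) * ξ)) ∂μ‖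
        ≤ ‖g z.1‖ * ‖g z.2‖ * (2 * (|s| ^ (β / 2) * |u| ^ (β / 2))) *
          (C₁ * (1 + |u|) ^ (-(β / 2))) := by
          gcongr
          · exact e2.trans e3
          · exact hdecay u
      _ = 2 * C₁ * |s| ^ (β / 2) * (‖g z.1‖ * ‖g z.2‖) *
          (|u| ^ (β / 2) * (1 + |u|) ^ (-(β / 2))) := by ring
      _ ≤ 2 * C₁ * |s| ^ (β / 2) * (‖g z.1‖ * ‖g z.2‖) :=
          mul_le_of_le_one_right (by positivity) e4
  rw [integral_const_mul, Measure.volume_eq_prod,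
    integral_prod_mul (fun x => ‖g x‖) (fun x => ‖g x‖), ← sq, ← Measure.volume_eq_prod,
    ← hdiff, Complex.norm_real] at hbound
  linarith [le_abs_self (∫ ξ, ‖angularFourier g ξ‖ ^ 2 ∂μ -
    ∫ ξ, ‖angularFourier g (ξ + s)‖ ^ 2 ∂μ), hbound, Real.norm_eq_abs
    (∫ ξ, ‖angularFourier g ξ‖ ^ 2 ∂μ - ∫ ξ, ‖angularFourier g (ξ + s)‖ ^ 2 ∂μ)]

/-- The average of the translates of a Frostman measure over `[-δ, δ]` has density bounded by
`δ ^ (α - 1)`. -/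
lemma setLIntegral_lintegral_translate_le {α C₀ : ℝ}
    (hfrostman : ∀ x r : ℝ, 0 < r → μ (Set.Icc (x - r) (x + r)) ≤ ENNReal.ofReal (C₀ * r ^ α))
    {F : ℝ → ℝ≥0∞} (hF : Measurable F) {δ : ℝ} (hδ : 0 < δ) :
    ∫⁻ s in Set.Icc (-δ) δ, ∫⁻ ξ, F (ξ + s) ∂μ ≤
      ENNReal.ofReal (C₀ * δ ^ α) * ∫⁻ t, F t := by
  have hset : MeasurableSet {q : ℝ × ℝ | |q.2 - q.1| ≤ δ} :=
    measurableSet_le (by fun_prop) measurable_const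
  rw [lintegral_lintegral_swap (by fun_prop)]
  have h1 : ∀ ξ, ∫⁻ s in Set.Icc (-δ) δ, F (ξ + s) =
      ∫⁻ t, {q : ℝ × ℝ | |q.2 - q.1| ≤ δ}.indicator (fun q => F q.2) (ξ, t) := by
    intro ξ
    rw [← lintegral_indicator measurableSet_Icc, ← lintegral_add_left_eq_self
      (fun t => {q : ℝ × ℝ | |q.2 - q.1| ≤ δ}.indicator (fun q => F q.2) (ξ, t)) ξ]
    congr 1
    ext s
    simp only [Set.indicator_apply, Set.mem_Icc, Set.mem_ofPred_eq, add_sub_cancel_left, abs_le]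
  simp_rw [h1]
  have hm : Measurable (Function.uncurry fun ξ t : ℝ =>
      {q : ℝ × ℝ | |q.2 - q.1| ≤ δ}.indicator (fun q => F q.2) (ξ, t)) :=
    (by fun_prop : Measurable fun q : ℝ × ℝ => F q.2).indicator hset
  rw [lintegral_lintegral_swap hm.aemeasurable, ← lintegral_const_mul _ hF]
  refine lintegral_mono fun t => ?_
  have h2 : ∀ ξ, {q : ℝ × ℝ | |q.2 - q.1| ≤ δ}.indicator (fun q => F q.2) (ξ, t) =
      (Set.Icc (t - δ) (t + δ)).indicator (fun _ => F t) ξ := by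
    intro ξ
    simp only [Set.indicator_apply, Set.mem_Icc, Set.mem_ofPred_eq, abs_le]
    congr 1
    exact propext ⟨fun h => ⟨by linarith, by linarith⟩, fun h => ⟨by linarith, by linarith⟩⟩
  simp_rw [h2]
  rw [lintegral_indicator measurableSet_Icc, setLIntegral_const, mul_comm]
  gcongr
  exact hfrostman t δ hδ

lemma lintegral_enorm_sq_angularFourier_le {α β C₀ C₁ : ℝ} (hβ : 0 < β) (hβ1 : β ≤ 1)
    (hC₀ : 0 < C₀) (hC₁ : 0 < C₁)
    (hfrostman : ∀ x r : ℝ, 0 < r → μ (Set.Icc (x - r) (x + r)) ≤ ENNReal.ofReal (C₀ * r ^ α))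
    (hdecay : ∀ ξ : ℝ,
      ‖∫ t, Complex.exp (-(Complex.I * ξ * t)) ∂μ‖ ≤ C₁ * (1 + |ξ|) ^ (-(β / 2)))
    {g : ℝ → ℂ} (hg : Integrable g) (hg2 : MemLp g 2) {δ : ℝ} (hδ : 0 < δ) :
    ∫⁻ ξ, ‖angularFourier g ξ‖ₑ ^ 2 ∂μ ≤
      ENNReal.ofReal (2 * C₁ * δ ^ (β / 2) * (∫ x, ‖g x‖) ^ 2 +
        π * C₀ * δ ^ (α - 1) * ∫ x, ‖g x‖ ^ 2) := by
  have hcont := continuous_angularFourier hg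
  have hint : ∀ s, Integrable (fun ξ => ‖angularFourier g (ξ + s)‖ ^ 2) μ := by
    intro s
    refine Integrable.of_bound (C := (∫ x, ‖g x‖) ^ 2)
      (by fun_prop : Continuous _).aestronglyMeasurable ?_
    filter_upwards with ξ
    rw [norm_pow, norm_norm]
    exact pow_le_pow_left₀ (norm_nonneg _) (norm_angularFourier_le g _) 2
  have hL : ∀ s, ∫⁻ ξ, ‖angularFourier g (ξ + s)‖ₑ ^ 2 ∂μ =
      ENNReal.ofReal (∫ ξ, ‖angularFourier g (ξ + s)‖ ^ 2 ∂μ) := by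
    intro s
    rw [ofReal_integral_eq_lintegral_ofReal (hint s) (ae_of_all _ fun _ => by positivity)]
    congr 1
    ext x
    rw [ENNReal.ofReal_pow (norm_nonneg _), ofReal_norm]
  have hL0 := hL 0
  simp only [add_zero] at hL0
  set D : ℝ := 2 * C₁ * δ ^ (β / 2) * (∫ x, ‖g x‖) ^ 2 with hD
  have hD0 : 0 ≤ D := by positivity
  have hN0 : 0 ≤ ∫ x, ‖g x‖ ^ 2 := integral_nonneg fun _ => by positivity
  have h1 : ∀ s ∈ Set.Icc (-δ) δ, ∫⁻ ξ, ‖angularFourier g ξ‖ₑ ^ 2 ∂μ ≤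
      ENNReal.ofReal D + ∫⁻ ξ, ‖angularFourier g (ξ + s)‖ₑ ^ 2 ∂μ := by
    intro s hs
    rw [hL0, hL s, ← ENNReal.ofReal_add hD0 (integral_nonneg fun _ => by positivity)]
    refine ENNReal.ofReal_le_ofReal
      ((integral_normSq_angularFourier_le_translate hβ hβ1 hdecay hg s).trans ?_)
    have hs' : |s| ≤ δ := abs_le.mpr hs
    rw [hD]
    gcongr
  have h2 := setLIntegral_mono_ae' (μ := volume) measurableSet_Icc (ae_of_all _ h1)
  rw [setLIntegral_const, lintegral_add_left measurable_const, setLIntegral_const,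
    Real.volume_Icc] at h2
  have h3 := h2.trans (add_le_add_right (setLIntegral_lintegral_translate_le hfrostman
    (by fun_prop : Measurable fun ξ => ‖angularFourier g ξ‖ₑ ^ 2) hδ) _)
  rw [lintegral_enorm_sq_angularFourier hg hg2, ← ENNReal.ofReal_mul hD0,
    ← ENNReal.ofReal_mul (show 0 ≤ C₀ * δ ^ α by positivity),
    ← ENNReal.ofReal_add (mul_nonneg hD0 (by linarith))
      (by positivity), hL0, ← ENNReal.ofReal_mul (integral_nonneg fun _ => by positivity),
    ENNReal.ofReal_le_ofReal_iff] at h3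
  · rw [hL0]
    refine ENNReal.ofReal_le_ofReal ?_
    have h4 : δ ^ (α - 1) = δ ^ α / δ := by rw [Real.rpow_sub hδ, Real.rpow_one]
    rw [h4]
    refine le_of_mul_le_mul_right (h3.trans_eq ?_) (by linarith : 0 < δ - -δ)
    field_simp
    ring
  · exact add_nonneg (mul_nonneg hD0 (by linarith)) (by positivity)

end DecayingMeasure

section Summation

lemma eLpNorm_two_angularFourier_le {μ : Measure ℝ} [IsFiniteMeasure μ] (g : ℝ → ℂ) :
    eLpNorm (angularFourier g) 2 μ ≤
      μ Set.univ ^ (1 / 2 : ℝ) * ENNReal.ofReal (∫ x, ‖g x‖) := by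
  refine (eLpNorm_le_of_ae_bound (C := ∫ x, ‖g x‖)
    (ae_of_all _ (norm_angularFourier_le g))).trans_eq ?_
  norm_num

lemma exists_balanced_exponent {α β p : ℝ} (hα : 0 < α) (hα1 : α ≤ 1) (hβ : 0 < β)
    (hp : p < 2 * (2 - 2 * α + β) / (4 * (1 - α) + β)) :
    ∃ N ε : ℝ, 0 < ε ∧ 2 * ε ≤ N * (β / 2) + (2 - 2 * p) ∧
      2 * ε ≤ N * (α - 1) + (2 - p) := by
  rw [lt_div_iff₀ (by nlinarith)] at hp
  set N₀ := 4 * (p - 1) / β with hN₀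
  have hN : N₀ * β = 4 * (p - 1) := by rw [hN₀]; field_simp
  have hgap : 0 < N₀ * (α - 1) + (2 - p) := by
    have : 0 < (N₀ * (α - 1) + (2 - p)) * β := by
      have : (N₀ * (α - 1) + (2 - p)) * β = (N₀ * β) * (α - 1) + (2 - p) * β := by ring
      rw [this, hN]
      nlinarith
    exact pos_of_mul_pos_left this hβ.le
  set G := N₀ * (α - 1) + (2 - p) with hG
  refine ⟨N₀ + G / 2, min (G * β / 8) (G / 4), by positivity, ?_, ?_⟩
  · have := min_le_left (G * β / 8) (G / 4)
    nlinarith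
  · have := min_le_right (G * β / 8) (G / 4)
    nlinarith

/-- A weak form of the restriction estimate for functions of size about `l`. -/
lemma eLpNorm_angularFourier_le_of_level {μ : Measure ℝ} {α β C p N ε : ℝ} (hC : 0 ≤ C)
    (hp1 : 1 ≤ p) (hp2 : p ≤ 2)
    (hε1 : 2 * ε ≤ N * (β / 2) + (2 - 2 * p)) (hε2 : 2 * ε ≤ N * (α - 1) + (2 - p))
    (hmain : ∀ g : ℝ → ℂ, Integrable g → MemLp g 2 → ∀ δ : ℝ, 0 < δ →
      ∫⁻ ξ, ‖angularFourier g ξ‖ₑ ^ 2 ∂μ ≤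
        ENNReal.ofReal (C * (δ ^ (β / 2) * (∫ x, ‖g x‖) ^ 2 + δ ^ (α - 1) * ∫ x, ‖g x‖ ^ 2)))
    {f : ℝ → ℂ} (hf : Integrable f) (hfm : Measurable f)
    (hfp : Integrable fun x => ‖f x‖ ^ p) (hfp1 : ∫ x, ‖f x‖ ^ p ≤ 1)
    {l : ℝ} (hl : 0 < l) (hl1 : l ≤ 1) :
    eLpNorm (angularFourier ({x | l / 2 ≤ ‖f x‖ ∧ ‖f x‖ < l}.indicator f)) 2 μ ≤
      ENNReal.ofReal (√(5 * C) * l ^ ε) := by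
  set S := {x | l / 2 ≤ ‖f x‖ ∧ ‖f x‖ < l}
  have hS : MeasurableSet S :=
    (measurableSet_le measurable_const hfm.norm).inter (measurableSet_lt hfm.norm measurable_const)
  set g := S.indicator f
  have hg : Integrable g := hf.indicator hS
  have hgp1 : ∀ x, ‖g x‖ ≤ 2 * l ^ (1 - p) * ‖f x‖ ^ p := by
    intro x
    by_cases hx : x ∈ S
    · have hx0 : 0 < ‖f x‖ := lt_of_lt_of_le (by linarith) hx.1
      have h1 : ‖f x‖ = ‖f x‖ ^ (1 - p) * ‖f x‖ ^ p := by
        rw [← Real.rpow_add hx0]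
        simp
      have h2 : ‖f x‖ ^ (1 - p) ≤ (l / 2) ^ (1 - p) :=
        Real.rpow_le_rpow_of_nonpos (by linarith) hx.1 (by linarith)
      have h3 : (l / 2) ^ (1 - p) ≤ 2 * l ^ (1 - p) := by
        rw [Real.div_rpow hl.le (by norm_num), div_eq_mul_inv, ← Real.rpow_neg (by norm_num),
          mul_comm]
        gcongr
        calc (2 : ℝ) ^ (-(1 - p)) ≤ 2 ^ (1 : ℝ) :=
              Real.rpow_le_rpow_of_exponent_le (by norm_num) (by linarith)
          _ = 2 := Real.rpow_one 2
      simp only [g, Set.indicator_of_mem hx]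
      conv_lhs => rw [h1]
      gcongr
      exact h2.trans h3
    · simp only [g, Set.indicator_of_notMem hx, norm_zero]
      positivity
  have hgp2 : ∀ x, ‖g x‖ ^ 2 ≤ l ^ (2 - p) * ‖f x‖ ^ p := by
    intro x
    by_cases hx : x ∈ S
    · have hx0 : 0 < ‖f x‖ := lt_of_lt_of_le (by linarith) hx.1
      have h1 : ‖f x‖ ^ 2 = ‖f x‖ ^ (2 - p) * ‖f x‖ ^ p := by
        rw [← Real.rpow_add hx0]
        simp
      simp only [g, Set.indicator_of_mem hx]
      rw [h1]
      gcongr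
      exact hx.2.le
    · simp only [g, Set.indicator_of_notMem hx, norm_zero, ne_eq, OfNat.ofNat_ne_zero,
        not_false_eq_true, zero_pow]
      positivity
  have hg2 : MemLp g 2 := by
    rw [memLp_two_iff_integrable_sq_norm hg.1]
    refine (hfp.const_mul (l ^ (2 - p))).mono' (hg.1.norm.pow 2) (ae_of_all _ fun x => ?_)
    rw [Real.norm_of_nonneg (by positivity)]
    exact hgp2 x
  have hI1 : ∫ x, ‖g x‖ ≤ 2 * l ^ (1 - p) := by
    calc ∫ x, ‖g x‖ ≤ ∫ x, 2 * l ^ (1 - p) * ‖f x‖ ^ p :=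
          integral_mono hg.norm (hfp.const_mul _) hgp1
      _ = 2 * l ^ (1 - p) * ∫ x, ‖f x‖ ^ p := integral_const_mul _ _
      _ ≤ 2 * l ^ (1 - p) := mul_le_of_le_one_right (by positivity) hfp1
  have hI2 : ∫ x, ‖g x‖ ^ 2 ≤ l ^ (2 - p) := by
    calc ∫ x, ‖g x‖ ^ 2 ≤ ∫ x, l ^ (2 - p) * ‖f x‖ ^ p :=
          integral_mono (hg2.integrable_norm_pow (by norm_num)) (hfp.const_mul _) hgp2
      _ = l ^ (2 - p) * ∫ x, ‖f x‖ ^ p := integral_const_mul _ _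
      _ ≤ l ^ (2 - p) := mul_le_of_le_one_right (by positivity) hfp1
  have hI0 : 0 ≤ ∫ x, ‖g x‖ := integral_nonneg fun _ => norm_nonneg _
  have hfin := hmain g hg hg2 (l ^ N) (by positivity)
  have hle : C * ((l ^ N) ^ (β / 2) * (∫ x, ‖g x‖) ^ 2 + (l ^ N) ^ (α - 1) * ∫ x, ‖g x‖ ^ 2) ≤
      (√(5 * C) * l ^ ε) ^ 2 := by
    have t1 : (l ^ N) ^ (β / 2) * (2 * l ^ (1 - p)) ^ 2 ≤ 4 * l ^ (2 * ε) := by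
      have : (l ^ N) ^ (β / 2) * (2 * l ^ (1 - p)) ^ 2
          = 4 * l ^ (N * (β / 2) + (2 - 2 * p)) := by
        rw [← Real.rpow_mul hl.le, mul_pow, ← Real.rpow_natCast (l ^ (1 - p)),
          ← Real.rpow_mul hl.le, Real.rpow_add hl]
        push_cast
        ring_nf
      rw [this]
      exact mul_le_mul_of_nonneg_left (Real.rpow_le_rpow_of_exponent_ge hl hl1 hε1) (by norm_num)
    have t2 : (l ^ N) ^ (α - 1) * l ^ (2 - p) ≤ l ^ (2 * ε) := by
      rw [← Real.rpow_mul hl.le, ← Real.rpow_add hl]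
      exact Real.rpow_le_rpow_of_exponent_ge hl hl1 hε2
    have t3 : (√(5 * C) * l ^ ε) ^ 2 = C * (4 * l ^ (2 * ε) + l ^ (2 * ε)) := by
      rw [mul_pow, Real.sq_sqrt (by positivity), ← Real.rpow_natCast (l ^ ε),
        ← Real.rpow_mul hl.le]
      push_cast
      ring_nf
    rw [t3]
    have a1 : (l ^ N) ^ (β / 2) * (∫ x, ‖g x‖) ^ 2 ≤ 4 * l ^ (2 * ε) := by
      refine le_trans ?_ t1
      gcongr
    have a2 : (l ^ N) ^ (α - 1) * ∫ x, ‖g x‖ ^ 2 ≤ l ^ (2 * ε) := by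
      refine le_trans ?_ t2
      gcongr
    gcongr
  rw [← eLpNorm_two_sq] at hfin
  have h2 := hfin.trans (ENNReal.ofReal_le_ofReal hle)
  rw [ENNReal.ofReal_pow (by positivity)] at h2
  exact (ENNReal.pow_le_pow_left_iff (by norm_num)).mp h2

lemma eLpNorm_angularFourier_add_le {μ : Measure ℝ} {f g : ℝ → ℂ} (hf : Integrable f)
    (hg : Integrable g) : eLpNorm (angularFourier (f + g)) 2 μ ≤
      eLpNorm (angularFourier f) 2 μ + eLpNorm (angularFourier g) 2 μ := by
  rw [angularFourier_add hf hg]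
  exact eLpNorm_add_le (continuous_angularFourier hf).aestronglyMeasurable
    (continuous_angularFourier hg).aestronglyMeasurable (by norm_num)

lemma tendsto_integral_norm_indicator_lt {f : ℝ → ℂ} (hf : Integrable f) (hfm : Measurable f) :
    Filter.Tendsto (fun n : ℕ => ∫ x, ‖{x | ‖f x‖ < (1 / 2 : ℝ) ^ n}.indicator f x‖)
      Filter.atTop (nhds 0) := by
  have hlim : Filter.Tendsto (fun n : ℕ => (1 / 2 : ℝ) ^ n) Filter.atTop (nhds 0) :=
    tendsto_pow_atTop_nhds_zero_of_lt_one (by norm_num) (by norm_num)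
  have := tendsto_integral_of_dominated_convergence (μ := volume)
    (F := fun (n : ℕ) x => ‖{x | ‖f x‖ < (1 / 2 : ℝ) ^ n}.indicator f x‖) (f := fun _ => (0 : ℝ))
    (fun x => ‖f x‖)
    (fun n => (hfm.indicator (measurableSet_lt hfm.norm measurable_const)).norm.aestronglyMeasurable)
    hf.norm (fun n => ae_of_all _ fun x => by
      rw [norm_norm]; exact norm_indicator_le_norm_self f x)
    (ae_of_all _ fun x => by
      refine squeeze_zero (fun _ => norm_nonneg _) (fun n => ?_) hlim
      by_cases hx : ‖f x‖ < (1 / 2 : ℝ) ^ n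
      · rw [Set.indicator_of_mem (by simpa using hx)]
        exact hx.le
      · rw [Set.indicator_of_notMem (by simpa using hx), norm_zero]
        positivity)
  simpa using this

/-- Estimates on the dyadic level sets sum up to a restriction estimate on the unit ball of
`Lᵖ`. -/
lemma eLpNorm_angularFourier_le_of_level_bounds {μ : Measure ℝ} [IsFiniteMeasure μ] {p : ℝ}
    (hp1 : 1 ≤ p) {B q : ℝ} (hB : 0 ≤ B) (hq : 0 ≤ q) (hq1 : q < 1)
    {f : ℝ → ℂ} (hf : Integrable f) (hfm : Measurable f)
    (hfp : Integrable fun x => ‖f x‖ ^ p) (hfp1 : ∫ x, ‖f x‖ ^ p ≤ 1)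
    (hlevel : ∀ n : ℕ, eLpNorm (angularFourier ({x | (1 / 2 : ℝ) ^ n / 2 ≤ ‖f x‖ ∧
      ‖f x‖ < (1 / 2 : ℝ) ^ n}.indicator f)) 2 μ ≤ ENNReal.ofReal (B * q ^ n)) :
    eLpNorm (angularFourier f) 2 μ ≤
      μ Set.univ ^ (1 / 2 : ℝ) + ENNReal.ofReal (B * (1 - q)⁻¹) := by
  have hlow : ∀ n : ℕ, MeasurableSet {x | ‖f x‖ < (1 / 2 : ℝ) ^ n} := fun n =>
    measurableSet_lt hfm.norm measurable_const
  have hband : ∀ n : ℕ, MeasurableSet {x | (1 / 2 : ℝ) ^ n / 2 ≤ ‖f x‖ ∧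
      ‖f x‖ < (1 / 2 : ℝ) ^ n} := fun n =>
    (measurableSet_le measurable_const hfm.norm).inter (measurableSet_lt hfm.norm measurable_const)
  have hhigh : MeasurableSet {x | 1 ≤ ‖f x‖} := measurableSet_le measurable_const hfm.norm
  have hfirst : eLpNorm (angularFourier f) 2 μ ≤ μ Set.univ ^ (1 / 2 : ℝ) +
      eLpNorm (angularFourier ({x | ‖f x‖ < (1 / 2 : ℝ) ^ 0}.indicator f)) 2 μ := by
    have hsplit : f = {x | 1 ≤ ‖f x‖}.indicator f +
        {x | ‖f x‖ < (1 / 2 : ℝ) ^ 0}.indicator f := by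
      ext x
      by_cases hx : 1 ≤ ‖f x‖
      · simp [Set.indicator, hx, not_lt.mpr hx]
      · simp [Set.indicator, hx, not_le.mp hx]
    conv_lhs => rw [hsplit]
    refine (eLpNorm_angularFourier_add_le (hf.indicator hhigh) (hf.indicator (hlow 0))).trans ?_
    gcongr
    refine (eLpNorm_two_angularFourier_le _).trans (mul_le_of_le_one_right' ?_)
    rw [ENNReal.ofReal_le_one]
    refine (integral_mono (hf.indicator hhigh).norm hfp fun x => ?_).trans hfp1
    by_cases hx : 1 ≤ ‖f x‖
    · simpa [Set.indicator, hx] using Real.self_le_rpow_of_one_le hx hp1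
    · simpa [Set.indicator, hx] using by positivity
  have hsum : ∀ n : ℕ, eLpNorm (angularFourier ({x | ‖f x‖ < (1 / 2 : ℝ) ^ 0}.indicator f)) 2 μ ≤
      ENNReal.ofReal (B * ∑ k ∈ Finset.range n, q ^ k) +
        eLpNorm (angularFourier ({x | ‖f x‖ < (1 / 2 : ℝ) ^ n}.indicator f)) 2 μ := by
    intro n
    induction n with
    | zero => simp
    | succ n ih =>
      have hsplit : {x | ‖f x‖ < (1 / 2 : ℝ) ^ n}.indicator f =
          {x | (1 / 2 : ℝ) ^ n / 2 ≤ ‖f x‖ ∧ ‖f x‖ < (1 / 2 : ℝ) ^ n}.indicator f +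
          {x | ‖f x‖ < (1 / 2 : ℝ) ^ (n + 1)}.indicator f := by
        ext x
        have hpow : (1 / 2 : ℝ) ^ (n + 1) = (1 / 2 : ℝ) ^ n / 2 := by ring
        have hpos : (0 : ℝ) < (1 / 2 : ℝ) ^ n := by positivity
        simp only [Set.indicator_apply, Set.mem_ofPred_eq, Pi.add_apply, hpow]
        rcases lt_or_ge ‖f x‖ ((1 / 2 : ℝ) ^ n / 2) with hx | hx
        · rw [if_pos (by linarith), if_neg (fun h => absurd h.1 (not_le.mpr hx)), if_pos hx,
            zero_add]
        · rw [if_neg (not_lt.mpr hx), add_zero]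
          simp only [hx, true_and]
      refine ih.trans ?_
      rw [hsplit, Finset.sum_range_succ, mul_add, ENNReal.ofReal_add (by positivity)
        (by positivity), add_assoc]
      gcongr
      exact (eLpNorm_angularFourier_add_le (hf.indicator (hband n))
        (hf.indicator (hlow (n + 1)))).trans (by gcongr; exact hlevel n)
  have htend : Filter.Tendsto (fun n : ℕ => ENNReal.ofReal (B * (1 - q)⁻¹) +
      μ Set.univ ^ (1 / 2 : ℝ) * ENNReal.ofReal
        (∫ x, ‖{x | ‖f x‖ < (1 / 2 : ℝ) ^ n}.indicator f x‖)) Filter.atTop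
      (nhds (ENNReal.ofReal (B * (1 - q)⁻¹) + μ Set.univ ^ (1 / 2 : ℝ) * ENNReal.ofReal 0)) := by
    refine tendsto_const_nhds.add (ENNReal.Tendsto.const_mul
      (ENNReal.tendsto_ofReal (tendsto_integral_norm_indicator_lt hf hfm)) (Or.inr ?_))
    exact ENNReal.rpow_ne_top_of_nonneg (by norm_num) (measure_ne_top _ _)
  have hlim := ge_of_tendsto' htend fun n => (hsum n).trans (by
    gcongr
    · rw [← tsum_geometric_of_lt_one hq hq1]
      exact (summable_geometric_of_lt_one hq hq1).sum_le_tsum _ fun _ _ => by positivity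
    · exact eLpNorm_two_angularFourier_le _)
  rw [ENNReal.ofReal_zero, mul_zero, add_zero] at hlim
  exact hfirst.trans (by gcongr)

end Summation

/-- Mockenhaupt's restriction theorem: if a nonzero compactly supported finite
measure `μ` on `ℝ` has Frostman exponent `α` and Fourier decay of order `β/2`, then the `L^p`-`L²`
restriction inequality holds for `1 ≤ p < 2(2-2α+β)/(4(1-α)+β)`. -/
theorem stmt7 (μ : Measure ℝ) [IsFiniteMeasure μ] (hμ : μ ≠ 0)
    (hcpt : ∃ K : Set ℝ, IsCompact K ∧ μ Kᶜ = 0)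
    (α β : ℝ) (hα : 0 < α) (hα1 : α ≤ 1) (hβ : 0 < β) (hβ1 : β ≤ 1)
    (C₀ C₁ : ℝ) (hC₀ : 0 < C₀) (hC₁ : 0 < C₁)
    (hfrostman : ∀ x r : ℝ, 0 < r → μ (Set.Icc (x - r) (x + r)) ≤ ENNReal.ofReal (C₀ * r ^ α))
    (hdecay : ∀ ξ : ℝ,
      ‖∫ t, Complex.exp (-(Complex.I * ξ * t)) ∂μ‖ ≤ C₁ * (1 + |ξ|) ^ (-(β / 2))) :
    ∀ p : ℝ, 1 ≤ p → p < 2 * (2 - 2 * α + β) / (4 * (1 - α) + β) →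
      ∃ A > (0 : ℝ), ∀ f : SchwartzMap ℝ ℂ,
        (∫ ξ, ‖∫ x, f x * Complex.exp (-(Complex.I * x * ξ))‖ ^ 2 ∂μ) ^ (1 / 2 : ℝ) ≤
          A * (eLpNorm (⇑f) (ENNReal.ofReal p) volume).toReal := by
  intro p hp1 hp
  obtain ⟨N, ε, hε, hε1, hε2⟩ := exists_balanced_exponent hα hα1 hβ hp
  have hp2 : p ≤ 2 := by
    refine hp.le.trans ?_
    rw [div_le_iff₀ (by nlinarith)]
    nlinarith
  set C : ℝ := 2 * C₁ + π * C₀ with hCdef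
  have hC : 0 ≤ C := by positivity
  have hmain : ∀ g : ℝ → ℂ, Integrable g → MemLp g 2 → ∀ δ : ℝ, 0 < δ →
      ∫⁻ ξ, ‖angularFourier g ξ‖ₑ ^ 2 ∂μ ≤
        ENNReal.ofReal (C * (δ ^ (β / 2) * (∫ x, ‖g x‖) ^ 2 +
          δ ^ (α - 1) * ∫ x, ‖g x‖ ^ 2)) := by
    intro g hg hg2 δ hδ
    refine (lintegral_enorm_sq_angularFourier_le hβ hβ1 hC₀ hC₁ hfrostman hdecay hg hg2
      hδ).trans (ENNReal.ofReal_le_ofReal ?_)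
    have h1 : 0 ≤ δ ^ (β / 2) * (∫ x, ‖g x‖) ^ 2 := by positivity
    have h2 : 0 ≤ δ ^ (α - 1) * ∫ x, ‖g x‖ ^ 2 :=
      mul_nonneg (by positivity) (integral_nonneg fun _ => by positivity)
    have h3 : 0 < π * C₀ := by positivity
    rw [hCdef]
    nlinarith [mul_nonneg h3.le h1, mul_nonneg hC₁.le h2]
  set q : ℝ := (1 / 2 : ℝ) ^ ε with hq
  have hq0 : 0 ≤ q := by positivity
  have hq1 : q < 1 := Real.rpow_lt_one (by norm_num) (by norm_num) hε
  set M := μ Set.univ ^ (1 / 2 : ℝ) + ENNReal.ofReal (√(5 * C) * (1 - q)⁻¹) with hM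
  have hMtop : M ≠ ⊤ := ENNReal.add_ne_top.mpr
    ⟨ENNReal.rpow_ne_top_of_nonneg (by norm_num) (measure_ne_top _ _), ENNReal.ofReal_ne_top⟩
  have hunit : ∀ g : ℝ → ℂ, Integrable g → Measurable g → Integrable (fun x => ‖g x‖ ^ p) →
      ∫ x, ‖g x‖ ^ p ≤ 1 → eLpNorm (angularFourier g) 2 μ ≤ M := by
    intro g hg hgm hgp hgp1
    refine eLpNorm_angularFourier_le_of_level_bounds hp1 (Real.sqrt_nonneg _) hq0 hq1 hg hgm hgp
      hgp1 fun n => ?_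
    refine (eLpNorm_angularFourier_le_of_level hC hp1 hp2 hε1 hε2 hmain hg hgm hgp hgp1
      (l := (1 / 2 : ℝ) ^ n) (by positivity) (pow_le_one₀ (by norm_num) (by norm_num))).trans_eq ?_
    rw [hq, ← Real.rpow_natCast, ← Real.rpow_natCast, ← Real.rpow_mul (by norm_num),
      ← Real.rpow_mul (by norm_num), mul_comm ε]
  refine ⟨M.toReal + 1, by positivity, fun f => ?_⟩
  have hp0 : 0 < p := by linarith
  have hf : Integrable f := f.integrable
  have hcont := continuous_angularFourier hf
  have hLHS : (∫ ξ, ‖∫ x, f x * Complex.exp (-(Complex.I * x * ξ))‖ ^ 2 ∂μ) ^ (1 / 2 : ℝ) =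
      (eLpNorm (angularFourier f) 2 μ).toReal := by
    have hb : MemLp (angularFourier f) 2 μ := MemLp.of_bound hcont.aestronglyMeasurable
      (∫ x, ‖f x‖) (ae_of_all _ (norm_angularFourier_le f))
    rw [hb.eLpNorm_eq_integral_rpow_norm (by norm_num) (by norm_num), ENNReal.toReal_ofReal
      (by positivity)]
    norm_num [angularFourier]
  rw [hLHS]
  have hmem : MemLp f (ENNReal.ofReal p) volume := f.memLp _ _
  have hpow : Integrable (fun x => ‖f x‖ ^ p) := by
    have := hmem.integrable_norm_rpow (by simpa using hp0) ENNReal.ofReal_ne_top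
    rwa [ENNReal.toReal_ofReal hp0.le] at this
  have hnorm : (eLpNorm f (ENNReal.ofReal p) volume).toReal = (∫ x, ‖f x‖ ^ p) ^ p⁻¹ := by
    rw [hmem.eLpNorm_eq_integral_rpow_norm (by simpa using hp0) ENNReal.ofReal_ne_top,
      ENNReal.toReal_ofReal hp0.le, ENNReal.toReal_ofReal (by positivity)]
  set c := (eLpNorm f (ENNReal.ofReal p) volume).toReal with hc
  have hc0 : 0 ≤ c := ENNReal.toReal_nonneg
  rcases hc0.eq_or_lt with hzero | hpos
  · have hI : eLpNorm f (ENNReal.ofReal p) volume = 0 :=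
      ((ENNReal.toReal_eq_zero_iff _).mp hzero.symm).resolve_right hmem.2.ne
    have hf0 : f =ᵐ[volume] 0 :=
      (eLpNorm_eq_zero_iff hf.1 (by simpa using hp0)).mp hI
    have hft : angularFourier f = 0 := by
      ext ξ
      refine integral_eq_zero_of_ae ?_
      filter_upwards [hf0] with x hx
      simp [hx]
    simp [hft, ← hzero]
  · have hg := hunit (fun x => ((c⁻¹ : ℝ) : ℂ) * f x) (hf.const_mul _)
      (f.continuous.measurable.const_mul _) ?_ ?_
    · have hft : angularFourier f =
          (c : ℂ) • angularFourier (fun x => ((c⁻¹ : ℝ) : ℂ) * f x) := by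
        ext ξ
        rw [Pi.smul_apply, angularFourier_const_mul, smul_eq_mul, ← mul_assoc,
          ← Complex.ofReal_mul, mul_inv_cancel₀ hpos.ne', Complex.ofReal_one, one_mul]
      rw [hft, eLpNorm_const_smul, ENNReal.toReal_mul, toReal_enorm, Complex.norm_real,
        Real.norm_of_nonneg hc0, mul_comm]
      gcongr
      exact (ENNReal.toReal_mono hMtop hg).trans (by linarith)
    · simp_rw [norm_mul, Complex.norm_real, Real.mul_rpow (norm_nonneg _) (norm_nonneg _)]
      exact hpow.const_mul _
    · simp_rw [norm_mul, Complex.norm_real, Real.mul_rpow (norm_nonneg _) (norm_nonneg _)]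
      rw [integral_const_mul, Real.norm_of_nonneg (by positivity), Real.inv_rpow hc0, hnorm,
        ← Real.rpow_mul (integral_nonneg fun _ => by positivity), inv_mul_cancel₀ hp0.ne',
        Real.rpow_one]
      exact inv_mul_le_one
end

section
/- Let μ be a finite Borel measure on ℝ with support contained in [0,1], let 0 < α ≤ 1, 0 < β ≤ 1, and suppose there are constants C₀, C₁ > 0 such that μ([x-r, x+r]) ≤ C₀ r^α for all x ∈ ℝ and r > 0, and such that for every integer k ≥ 0 and every ξ ∈ ℝ, |∫_ℝ t^k e^{-i ξ t} dμ(t)| ≤ C₁ (1+|ξ|)^{-β/2}. For k ≥ 0 let h_k(ξ) = ∫_ℝ t^k e^{-i ξ t} dμ(t). Then for every p with 1 ≤ p < 2(2-2α+β)/(4(1-α)+β) there exists a constant C_p > 0 such that for every integer k ≥ 0 and every Schwartz function f : ℝ → ℂ, ‖f * h_k‖_{L^{p'}(ℝ)} ≤ C_p ‖f‖_{L^p(ℝ)}, where p' = p/(p-1) is the conjugate exponent and (f * h_k)(x) = ∫_ℝ f(x-y) h_k(y) dy. -/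
open MeasureTheory Complex Real

/-- The Fourier transform `h_k(ξ) = ∫ t^k e^{-i ξ t} dμ(t)` of the moment measure `t^k dμ`. -/
noncomputable def momFT1 (μ : Measure ℝ) (k : ℕ) (ξ : ℝ) : ℂ :=
  ∫ t, (t : ℂ) ^ k * Complex.exp (-(Complex.I * ξ * t)) ∂μ

section Fourier

open scoped FourierTransform Convolution SchwartzMap ContDiff

/-- On `L¹ ∩ L²` the `L²` Fourier transform is given by the Fourier integral. -/
theorem fourier_toLp_ae_eq {F : ℝ → ℂ} (h1 : Integrable F) (h2 : MemLp F 2) :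
    (𝓕 (h2.toLp F) : Lp ℂ 2 (volume : Measure ℝ)) =ᵐ[volume] 𝓕 F := by
  have hcont : Continuous (𝓕 F) :=
    VectorFourier.fourierIntegral_continuous Real.continuous_fourierChar continuous_inner h1
  refine ae_eq_of_integral_contDiff_smul_eq
    ((Lp.memLp _).locallyIntegrable (by norm_num)) hcont.locallyIntegrable fun g hg hgc => ?_
  have hgc' : HasCompactSupport (fun x => (g x : ℂ)) := hgc.comp_left (g := Complex.ofReal) rfl
  have hg' : ContDiff ℝ ∞ (fun x => (g x : ℂ)) := Complex.ofRealCLM.contDiff.comp hg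
  let φ : 𝓢(ℝ, ℂ) := hgc'.toSchwartzMap hg'
  have hφ : ∀ x, φ x = (g x : ℂ) := fun x => rfl
  have key := congrArg (fun T => T φ) (Lp.fourier_toTemperedDistribution_eq (h2.toLp F))
  simp only [TemperedDistribution.fourier_apply, Lp.toTemperedDistribution_apply] at key
  have e1 : ∀ x (z : ℂ), g x • z = φ x • z := fun x z => by simp [hφ]
  simp_rw [e1]
  rw [← key]
  have e2 : ∫ x, (𝓕 φ : 𝓢(ℝ, ℂ)) x • (h2.toLp F) x = ∫ x, 𝓕 (φ : ℝ → ℂ) x • F x := by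
    refine integral_congr_ae ?_
    filter_upwards [h2.coeFn_toLp] with x hx
    rw [hx, SchwartzMap.fourier_coe]
  rw [e2]
  exact VectorFourier.integral_fourierIntegral_smul_eq_flip (L := innerₗ ℝ)
    Real.continuous_fourierChar continuous_inner φ.integrable h1 |>.trans (by
      congr 1; ext x; congr 1; simp [Real.fourier_eq, VectorFourier.fourierIntegral])

/-- **Plancherel's theorem** on `L¹ ∩ L²`. -/
theorem eLpNorm_fourier_eq {F : ℝ → ℂ} (h1 : Integrable F) (h2 : MemLp F 2) :
    eLpNorm (𝓕 F) 2 volume = eLpNorm F 2 volume := by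
  rw [← eLpNorm_congr_ae (fourier_toLp_ae_eq h1 h2), ← eLpNorm_congr_ae h2.coeFn_toLp,
    ← Lp.enorm_def, ← Lp.enorm_def, ← ofReal_norm, ← ofReal_norm,
    Lp.norm_fourier_eq]

theorem integrable_comp_sub_mul {K g : ℝ → ℂ} {A : ℝ} (hg : Integrable g)
    (hK : AEStronglyMeasurable K) (hA : ∀ x, ‖K x‖ ≤ A) (x : ℝ) :
    Integrable fun y => g (x - y) * K y :=
  (hg.comp_sub_left x).mul_bdd hK (Filter.Eventually.of_forall hA)

theorem norm_integral_comp_sub_mul_le {K g : ℝ → ℂ} {A : ℝ} (hg : Integrable g)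
    (hA : ∀ x, ‖K x‖ ≤ A) (x : ℝ) :
    ‖∫ y, g (x - y) * K y‖ ≤ A * ∫ y, ‖g y‖ := by
  rw [← integral_sub_left_eq_self (fun y => ‖g y‖) volume x, ← integral_const_mul]
  refine norm_integral_le_of_norm_le ((hg.comp_sub_left x).norm.const_mul A) ?_
  filter_upwards with y
  rw [norm_mul, mul_comm]
  gcongr
  exact hA y

theorem aestronglyMeasurable_integral_comp_sub_mul {K g : ℝ → ℂ} (hg : Integrable g)
    (hK : Integrable K) : AEStronglyMeasurable (fun x => ∫ y, g (x - y) * K y) := by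
  have h := (hK.integrable_convolution (ContinuousLinearMap.mul ℂ ℂ) hg).aestronglyMeasurable
  refine h.congr (Filter.Eventually.of_forall fun x => ?_)
  simp [convolution_def, mul_comm]

/-- Convolution with an integrable kernel `K` is bounded on `L²` by `‖𝓕 K‖_∞`. -/
theorem eLpNorm_two_convolution_le {K g : ℝ → ℂ} {A B : ℝ} (hK : Integrable K)
    (hA : ∀ x, ‖K x‖ ≤ A) (hB : ∀ v, ‖𝓕 K v‖ ≤ B) (hg : Integrable g) (hg2 : MemLp g 2) :
    eLpNorm (fun x => ∫ y, g (x - y) * K y) 2 volume ≤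
      ENNReal.ofReal B * eLpNorm g 2 volume := by
  have hconv : (fun x => ∫ y, g (x - y) * K y) =
      K ⋆[ContinuousLinearMap.mul ℂ ℂ, volume] g := by
    ext x
    simp [convolution_def, mul_comm]
  have hbd : ∀ x, ‖(K ⋆[ContinuousLinearMap.mul ℂ ℂ, volume] g) x‖ ≤ A * ∫ y, ‖g y‖ :=
    fun x => hconv ▸ norm_integral_comp_sub_mul_le hg hA x
  have hint : Integrable (K ⋆[ContinuousLinearMap.mul ℂ ℂ, volume] g) :=
    hK.integrable_convolution _ hg
  have h2 : MemLp (K ⋆[ContinuousLinearMap.mul ℂ ℂ, volume] g) 2 := by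
    rw [memLp_two_iff_integrable_sq_norm hint.aestronglyMeasurable]
    simp_rw [sq]
    exact hint.norm.bdd_mul hint.norm.aestronglyMeasurable
      (Filter.Eventually.of_forall fun x => by simpa using hbd x)
  rw [hconv, ← eLpNorm_fourier_eq hint h2, ← eLpNorm_fourier_eq hg hg2]
  refine eLpNorm_le_mul_eLpNorm_of_ae_le_mul ?_ 2
  filter_upwards with v
  rw [Real.fourier_mul_convolution_eq hK hg, norm_mul]
  gcongr
  exact hB v

end Fourier

section Interpolation

/-- The truncation level set in the interpolation argument, integrated over all levels. -/
theorem lintegral_level_rpow_le {u D p q : ℝ} (hu : 0 ≤ u) (hD : 0 < D)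
    (hpq : p.HolderConjugate q) (hq : 2 < q) :
    ∫⁻ s in Set.Ioi (0 : ℝ), (if s * u ^ (p - 1) ≤ D then
      ENNReal.ofReal (s ^ (q - 3)) * ENNReal.ofReal (u ^ 2) else 0) ≤
      ENNReal.ofReal (D ^ (q - 2) / (q - 2) * u ^ p) := by
  rcases hu.eq_or_lt with rfl | hu
  · simp
  have hw : 0 < u ^ (p - 1) := Real.rpow_pos_of_pos hu _
  set a := D / u ^ (p - 1) with ha
  have ha0 : 0 < a := by positivity
  have h1 : ∀ s : ℝ, (if s * u ^ (p - 1) ≤ D then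
      ENNReal.ofReal (s ^ (q - 3)) * ENNReal.ofReal (u ^ 2) else 0) =
      (Set.Iic a).indicator
        (fun s => ENNReal.ofReal (s ^ (q - 3)) * ENNReal.ofReal (u ^ 2)) s := by
    intro s
    simp only [Set.indicator, Set.mem_Iic, ha, le_div_iff₀ hw]
  simp_rw [h1]
  rw [lintegral_indicator measurableSet_Iic, Measure.restrict_restrict measurableSet_Iic,
    Set.Iic_inter_Ioi, lintegral_mul_const _ (by fun_prop),
    ← ofReal_integral_eq_lintegral_ofReal, ← intervalIntegral.integral_of_le ha0.le,
    integral_rpow (Or.inl (by linarith)), Real.zero_rpow (by linarith),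
    ← ENNReal.ofReal_mul' (by positivity)]
  · refine ENNReal.ofReal_le_ofReal (le_of_eq ?_)
    have e : (p - 1) * (q - 2) = 2 - p := by
      have := hpq.mul_eq_add
      linarith
    have e2 : q - 3 + 1 = q - 2 := by ring
    rw [e2, sub_zero, ha, Real.div_rpow hD.le hw.le, ← Real.rpow_mul hu.le, e,
      ← Real.rpow_natCast u 2]
    have : u ^ p * u ^ (2 - p) = u ^ ((2 : ℕ) : ℝ) := by
      rw [← Real.rpow_add hu]; congr 1; push_cast; ring
    rw [← this]
    field_simp
  · rw [← IntegrableOn, ← intervalIntegrable_iff_integrableOn_Ioc_of_le ha0.le]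
    exact intervalIntegral.intervalIntegrable_rpow' (by linarith)
  · filter_upwards [ae_restrict_mem measurableSet_Ioc] with s hs
    exact Real.rpow_nonneg hs.1.le _

/-- The part of `f` above the truncation level has small `L¹` norm. -/
theorem integral_norm_indicator_le {f : ℝ → ℂ} {p s D : ℝ} (hp : 1 < p)
    (hfp : MemLp f (ENNReal.ofReal p)) (hs : 0 < s) (hD : 0 < D) :
    ∫ x, ‖{x | s * ‖f x‖ ^ (p - 1) ≤ D}ᶜ.indicator f x‖ ≤ s / D * ∫ x, ‖f x‖ ^ p := by
  have hint : Integrable (fun x => ‖f x‖ ^ p) := by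
    have := hfp.integrable_norm_rpow (by simp; linarith) ENNReal.ofReal_ne_top
    rwa [ENNReal.toReal_ofReal (by linarith)] at this
  rw [← integral_const_mul]
  refine integral_mono_of_nonneg (Filter.Eventually.of_forall fun x => norm_nonneg _)
    (hint.const_mul _) (Filter.Eventually.of_forall fun x => ?_)
  by_cases hx : s * ‖f x‖ ^ (p - 1) ≤ D
  · have : x ∉ {x | s * ‖f x‖ ^ (p - 1) ≤ D}ᶜ := by simpa using hx
    simp only [Set.indicator_of_notMem this, norm_zero]
    positivity
  · have hx' : x ∈ {x | s * ‖f x‖ ^ (p - 1) ≤ D}ᶜ := hx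
    simp only [Set.indicator_of_mem hx']
    have e : ‖f x‖ ^ p = ‖f x‖ * ‖f x‖ ^ (p - 1) := by
      rw [← Real.rpow_one_add' (norm_nonneg _) (by linarith)]; congr 1; ring
    rw [e, div_mul_eq_mul_div, le_div_iff₀ hD]
    push Not at hx
    nlinarith [norm_nonneg (f x)]

/-- **Real interpolation** of an additive operator between `L¹ → L^∞` and `L² → L²`. -/
theorem eLpNorm_le_of_bound_one_two {T : (ℝ → ℂ) → ℝ → ℂ} {A B p q : ℝ} (hA : 0 < A) (hB : 0 < B)
    (hpq : p.HolderConjugate q) (hp2 : p < 2)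
    (hadd : ∀ g₁ g₂, Integrable g₁ → Integrable g₂ → ∀ x, T (g₁ + g₂) x = T g₁ x + T g₂ x)
    (hmeas : ∀ g, Integrable g → AEStronglyMeasurable (T g))
    (h1 : ∀ g, Integrable g → ∀ x, ‖T g x‖ ≤ A * ∫ y, ‖g y‖)
    (h2 : ∀ g, Integrable g → MemLp g 2 →
      eLpNorm (T g) 2 volume ≤ ENNReal.ofReal B * eLpNorm g 2 volume)
    {f : ℝ → ℂ} (hf : Measurable f) (hf1 : Integrable f) (hf2 : MemLp f 2)
    (hfp : MemLp f (ENNReal.ofReal p)) :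
    eLpNorm (T f) (ENNReal.ofReal q) volume ≤
      ENNReal.ofReal (2 * (q / (q - 2)) ^ (1 / q) * (A ^ (q - 2) * B ^ 2) ^ (1 / q)) *
        eLpNorm f (ENNReal.ofReal p) volume := by
  have hp1 : 1 < p := hpq.lt
  have hp0 : 0 < p := hpq.pos
  have hq0 : 0 < q := hpq.symm.pos
  have hmul := hpq.mul_eq_add
  have hq2 : 2 < q := by nlinarith [hpq.symm.lt]
  set m := ∫ x, ‖f x‖ ^ p with hm
  have hint : Integrable (fun x => ‖f x‖ ^ p) := by
    have := hfp.integrable_norm_rpow (by simp; linarith) ENNReal.ofReal_ne_top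
    rwa [ENNReal.toReal_ofReal (by linarith)] at this
  have hm0 : 0 ≤ m := integral_nonneg fun x => by positivity
  have hnorm : eLpNorm f (ENNReal.ofReal p) volume = ENNReal.ofReal (m ^ (1 / p)) := by
    rw [hfp.eLpNorm_eq_integral_rpow_norm (by simp; linarith) ENNReal.ofReal_ne_top,
      ENNReal.toReal_ofReal hp0.le, one_div]
  rcases hm0.eq_or_lt with hm00 | hmpos
  · have hf0 : f =ᵐ[volume] 0 := by
      rw [← eLpNorm_eq_zero_iff hf.aestronglyMeasurable (ENNReal.ofReal_pos.2 hp0).ne', hnorm,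
        ← hm00,
        Real.zero_rpow (by positivity), ENNReal.ofReal_zero]
    have hT0 : T f = 0 := by
      ext x
      have h0 : ∫ y, ‖f y‖ = 0 := by
        rw [integral_congr_ae (g := fun _ => (0 : ℝ)) (by
          filter_upwards [hf0] with y hy; simp [hy]), integral_zero]
      have := h1 f hf1 x
      rw [h0, mul_zero] at this
      simpa using this
    rw [hT0]; simp
  set D := A * m with hDdef
  have hD : 0 < D := by positivity
  let S : ℝ → Set ℝ := fun s => {x | s * ‖f x‖ ^ (p - 1) ≤ D}
  have hS : ∀ s, MeasurableSet (S s) := fun s => measurableSet_le (by fun_prop) (by fun_prop)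
  let G : ℝ → ℝ → ENNReal := fun s x => if s * ‖f x‖ ^ (p - 1) ≤ D then
      ENNReal.ofReal (s ^ (q - 3)) * ENNReal.ofReal (‖f x‖ ^ 2) else 0
  have hGm : Measurable (Function.uncurry G) := by
    refine Measurable.ite (measurableSet_le ?_ ?_) ?_ ?_ <;> fun_prop
  -- the distributional estimate
  have hdist : ∀ s ∈ Set.Ioi (0 : ℝ), volume {x | s < ‖T f x‖ / 2} * ENNReal.ofReal (s ^ (q - 1)) ≤
      ENNReal.ofReal (B ^ 2) * ∫⁻ x, G s x := by
    intro s hs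
    have hs : 0 < s := hs
    have hlow1 : Integrable ((S s).indicator f) := hf1.indicator (hS s)
    have hhigh1 : Integrable ((S s)ᶜ.indicator f) := hf1.indicator (hS s).compl
    have hlow2 : MemLp ((S s).indicator f) 2 := hf2.indicator (hS s)
    have hsub : {x | s < ‖T f x‖ / 2} ⊆
        {x | ENNReal.ofReal s ≤ ‖T ((S s).indicator f) x‖ₑ} := by
      intro x hx
      have hx : s < ‖T f x‖ / 2 := hx
      have hsplit : T f x = T ((S s).indicator f) x + T ((S s)ᶜ.indicator f) x := by
        rw [← hadd _ _ hlow1 hhigh1, Set.indicator_self_add_compl]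
      have hhigh : ‖T ((S s)ᶜ.indicator f) x‖ ≤ s := by
        refine (h1 _ hhigh1 x).trans ?_
        have := integral_norm_indicator_le hp1 hfp hs hD
        calc A * ∫ y, ‖(S s)ᶜ.indicator f y‖ ≤ A * (s / D * m) := by gcongr
          _ = s := by rw [hDdef]; field_simp
      have := norm_add_le (T ((S s).indicator f) x) (T ((S s)ᶜ.indicator f) x)
      rw [← hsplit] at this
      show ENNReal.ofReal s ≤ ‖T ((S s).indicator f) x‖ₑ
      rw [← ofReal_norm]
      exact ENNReal.ofReal_le_ofReal (by linarith)
    have hcheb := meas_ge_le_mul_pow_eLpNorm_enorm volume (p := 2) (by norm_num) (by norm_num)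
      (hmeas _ hlow1) (ε := ENNReal.ofReal s) (by simpa using hs) (by simp)
    have hlowint : eLpNorm ((S s).indicator f) 2 volume ^ (2 : ℝ) =
        ∫⁻ x, (if s * ‖f x‖ ^ (p - 1) ≤ D then ENNReal.ofReal (‖f x‖ ^ 2) else 0) := by
      rw [eLpNorm_eq_lintegral_rpow_enorm_toReal (by norm_num) (by norm_num)]
      simp only [ENNReal.toReal_ofNat]
      rw [← ENNReal.rpow_mul, one_div, inv_mul_cancel₀ (by norm_num), ENNReal.rpow_one]
      refine lintegral_congr fun x => ?_
      by_cases hx : s * ‖f x‖ ^ (p - 1) ≤ D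
      · have : x ∈ S s := hx
        rw [Set.indicator_of_mem this, if_pos hx, ← ofReal_norm,
          ENNReal.ofReal_rpow_of_nonneg (norm_nonneg _) (by norm_num)]
        norm_num
      · have : x ∉ S s := hx
        rw [Set.indicator_of_notMem this, if_neg hx]
        simp
    calc volume {x | s < ‖T f x‖ / 2} * ENNReal.ofReal (s ^ (q - 1))
        ≤ (ENNReal.ofReal s)⁻¹ ^ (2 : ℝ) *
          (ENNReal.ofReal B * eLpNorm ((S s).indicator f) 2 volume) ^ (2 : ℝ) *
          ENNReal.ofReal (s ^ (q - 1)) := by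
          gcongr
          refine (measure_mono hsub).trans (hcheb.trans ?_)
          simp only [ENNReal.toReal_ofNat]
          gcongr
          exact h2 _ hlow1 hlow2
      _ = ENNReal.ofReal (B ^ 2) * (ENNReal.ofReal (s ^ (q - 3)) *
          ∫⁻ x, (if s * ‖f x‖ ^ (p - 1) ≤ D then ENNReal.ofReal (‖f x‖ ^ 2) else 0)) := by
          rw [ENNReal.mul_rpow_of_nonneg _ _ (by norm_num), hlowint,
            ENNReal.ofReal_rpow_of_pos hB, ← ENNReal.ofReal_inv_of_pos hs,
            ENNReal.ofReal_rpow_of_pos (by positivity)]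
          have : ENNReal.ofReal (s ^ (q - 3)) =
              ENNReal.ofReal (s⁻¹ ^ (2 : ℝ)) * ENNReal.ofReal (s ^ (q - 1)) := by
            rw [← ENNReal.ofReal_mul (by positivity), Real.inv_rpow hs.le,
              ← Real.rpow_neg hs.le, ← Real.rpow_add hs]
            congr 2; ring
          simp only [this, Real.rpow_two]
          ring
      _ = ENNReal.ofReal (B ^ 2) * ∫⁻ x, G s x := by
          rw [← lintegral_const_mul']
          · congr 1
            refine lintegral_congr fun x => ?_
            simp only [G]
            split_ifs <;> simp
          · exact ENNReal.ofReal_ne_top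
  have hmain : ∫⁻ x, ENNReal.ofReal ((‖T f x‖ / 2) ^ q) ≤
      ENNReal.ofReal (q * (B ^ 2 * (D ^ (q - 2) / (q - 2) * m))) := by
    rw [lintegral_rpow_eq_lintegral_meas_lt_mul volume
      (Filter.Eventually.of_forall fun x => by positivity)
      ((hmeas f hf1).norm.aemeasurable.div_const 2) hq0, ENNReal.ofReal_mul hq0.le]
    gcongr
    calc _ ≤ ∫⁻ s in Set.Ioi (0 : ℝ), ENNReal.ofReal (B ^ 2) * ∫⁻ x, G s x :=
          setLIntegral_mono' measurableSet_Ioi hdist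
      _ = ENNReal.ofReal (B ^ 2) * ∫⁻ x, ∫⁻ s in Set.Ioi (0 : ℝ), G s x := by
          rw [lintegral_const_mul' _ _ ENNReal.ofReal_ne_top,
            lintegral_lintegral_swap hGm.aemeasurable]
      _ ≤ ENNReal.ofReal (B ^ 2) *
          ∫⁻ x, ENNReal.ofReal (D ^ (q - 2) / (q - 2) * ‖f x‖ ^ p) := by
          gcongr with x
          exact lintegral_level_rpow_le (norm_nonneg _) hD hpq hq2
      _ = _ := by
          have hq2' : 0 < q - 2 := by linarith
          rw [← ofReal_integral_eq_lintegral_ofReal (hint.const_mul _)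
            (Filter.Eventually.of_forall fun x => by positivity), integral_const_mul,
            ← ENNReal.ofReal_mul (by positivity)]
  have hq2' : 0 < q - 2 := by linarith
  set Q := q * (B ^ 2 * (D ^ (q - 2) / (q - 2) * m)) with hQ
  have hQ0 : 0 ≤ Q := by positivity
  rw [hnorm, ← ENNReal.ofReal_mul (by positivity),
    eLpNorm_eq_lintegral_rpow_enorm_toReal (by simpa using hq0) ENNReal.ofReal_ne_top,
    ENNReal.toReal_ofReal hq0.le]
  have hTq : ∀ x, ‖T f x‖ₑ ^ q = ENNReal.ofReal (2 ^ q) * ENNReal.ofReal ((‖T f x‖ / 2) ^ q) := by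
    intro x
    rw [← ENNReal.ofReal_mul (by positivity), ← Real.mul_rpow (by norm_num) (by positivity),
      mul_div_cancel₀ _ (by norm_num), ← ofReal_norm,
      ENNReal.ofReal_rpow_of_nonneg (norm_nonneg _) hq0.le]
  simp_rw [hTq]
  rw [lintegral_const_mul' _ _ ENNReal.ofReal_ne_top]
  calc _ ≤ (ENNReal.ofReal (2 ^ q) * ENNReal.ofReal Q) ^ (1 / q) := by gcongr
    _ = ENNReal.ofReal (2 * Q ^ (1 / q)) := by
        rw [← ENNReal.ofReal_mul (by positivity),
          ENNReal.ofReal_rpow_of_nonneg (by positivity) (by positivity),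
          Real.mul_rpow (by positivity) hQ0, ← Real.rpow_mul (by norm_num),
          mul_one_div_cancel hq0.ne', Real.rpow_one]
    _ = _ := by
        congr 1
        have hQe : Q = q / (q - 2) * (A ^ (q - 2) * B ^ 2) * m ^ (q - 1) := by
          have : m ^ (q - 1) = m ^ (q - 2) * m := by
            rw [← Real.rpow_add_one hmpos.ne']; congr 1; ring
          rw [hQ, this, hDdef, Real.mul_rpow hA.le hmpos.le]
          field_simp
        have hexp : (q - 1) * (1 / q) = 1 / p := by
          field_simp
          linarith
        rw [hQe, Real.mul_rpow (by positivity) (by positivity),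
          Real.mul_rpow (by positivity) (by positivity), ← Real.rpow_mul hmpos.le, hexp]
        ring

end Interpolation

section Moments

open scoped FourierTransform

theorem ae_norm_pow_le_one {μ : Measure ℝ} (hsupp : μ (Set.Icc (0 : ℝ) 1)ᶜ = 0) (k : ℕ) :
    ∀ᵐ (t : ℝ) ∂μ, ‖(t : ℂ) ^ k‖ ≤ 1 := by
  have : ∀ᵐ t ∂μ, t ∈ Set.Icc (0 : ℝ) 1 := hsupp
  filter_upwards [this] with t ht
  rw [norm_pow, Complex.norm_real]
  exact pow_le_one₀ (norm_nonneg _) ((abs_of_nonneg ht.1).trans_le ht.2)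

theorem continuous_momFT1 {μ : Measure ℝ} [IsFiniteMeasure μ]
    (hsupp : μ (Set.Icc (0 : ℝ) 1)ᶜ = 0) (k : ℕ) : Continuous (momFT1 μ k) := by
  refine continuous_of_dominated (bound := fun _ => 1)
    (fun ξ => (Continuous.aestronglyMeasurable (by fun_prop))) (fun ξ => ?_)
    (integrable_const _) (Filter.Eventually.of_forall fun t => by fun_prop)
  filter_upwards [ae_norm_pow_le_one hsupp k] with t ht
  rw [norm_mul]
  have : ‖cexp (-(I * ξ * t))‖ = 1 := by
    rw [Complex.norm_exp]; simp
  rwa [this, mul_one]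

theorem summable_succ_mul_exp_neg : Summable fun n : ℕ => ((n : ℝ) + 1) * Real.exp (-n) := by
  have h1 := Real.summable_pow_mul_exp_neg_nat_mul 1 (r := 1) one_pos
  have h0 := Real.summable_pow_mul_exp_neg_nat_mul 0 (r := 1) one_pos
  refine (h1.add h0).congr fun n => ?_
  simp
  ring

/-- The Gaussian averages of a Frostman measure. -/
theorem integral_gaussian_le_of_frostman {μ : Measure ℝ} {α C₀ : ℝ}
    (hα1 : α ≤ 1) (hC₀ : 0 < C₀)
    (hfrostman : ∀ x r : ℝ, 0 < r → μ (Set.Icc (x - r) (x + r)) ≤ ENNReal.ofReal (C₀ * r ^ α))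
    {a : ℝ} (ha : 0 < a) (v : ℝ) :
    ∫ t, Real.exp (-(a * (t - v)) ^ 2) ∂μ ≤
      C₀ * a ^ (-α) * ∑' n : ℕ, ((n : ℝ) + 1) * Real.exp (-n) := by
  have hS : 0 ≤ ∑' n : ℕ, ((n : ℝ) + 1) * Real.exp (-n) := tsum_nonneg fun n => by positivity
  rw [integral_eq_lintegral_of_nonneg_ae (Filter.Eventually.of_forall fun t => by positivity)
    (by fun_prop)]
  refine ENNReal.toReal_le_of_le_ofReal (by positivity) ?_
  have hpt : ∀ t : ℝ, ENNReal.ofReal (Real.exp (-(a * (t - v)) ^ 2)) ≤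
      ∑' n : ℕ, (Set.Icc (v - (n + 1) / a) (v + (n + 1) / a)).indicator
        (fun _ => ENNReal.ofReal (Real.exp (-n))) t := by
    intro t
    refine le_trans ?_ (ENNReal.le_tsum ⌊|a * (t - v)|⌋₊)
    set n := ⌊|a * (t - v)|⌋₊
    have hn1 : (n : ℝ) ≤ |a * (t - v)| := Nat.floor_le (abs_nonneg _)
    have hn2 : |a * (t - v)| < n + 1 := Nat.lt_floor_add_one _
    have hmem : t ∈ Set.Icc (v - (n + 1) / a) (v + (n + 1) / a) := by
      rw [abs_mul, abs_of_pos ha, mul_comm, ← lt_div_iff₀ ha, abs_lt] at hn2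
      constructor <;> linarith [hn2.1, hn2.2]
    rw [Set.indicator_of_mem hmem]
    refine ENNReal.ofReal_le_ofReal (Real.exp_le_exp.2 ?_)
    have h3 : (n : ℝ) ≤ (n : ℝ) ^ 2 := by exact_mod_cast Nat.le_self_pow two_ne_zero n
    have h4 : (n : ℝ) ^ 2 ≤ |a * (t - v)| ^ 2 := by gcongr
    rw [sq_abs] at h4
    linarith
  calc ∫⁻ t, ENNReal.ofReal (Real.exp (-(a * (t - v)) ^ 2)) ∂μ
      ≤ ∫⁻ t, ∑' n : ℕ, (Set.Icc (v - (n + 1) / a) (v + (n + 1) / a)).indicator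
        (fun _ => ENNReal.ofReal (Real.exp (-n))) t ∂μ := lintegral_mono hpt
    _ = ∑' n : ℕ, ENNReal.ofReal (Real.exp (-n)) *
          μ (Set.Icc (v - (n + 1) / a) (v + (n + 1) / a)) := by
        rw [lintegral_tsum fun n => (measurable_const.indicator measurableSet_Icc).aemeasurable]
        simp_rw [lintegral_indicator_const measurableSet_Icc]
    _ ≤ ∑' n : ℕ, ENNReal.ofReal (C₀ * a ^ (-α) * (((n : ℝ) + 1) * Real.exp (-n))) := by
        gcongr with n
        refine (mul_le_mul_right (hfrostman v ((n + 1) / a) (by positivity)) _).trans ?_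
        rw [← ENNReal.ofReal_mul (by positivity)]
        refine ENNReal.ofReal_le_ofReal ?_
        rw [Real.div_rpow (by positivity) ha.le, Real.rpow_neg ha.le]
        have : ((n : ℝ) + 1) ^ α ≤ (n : ℝ) + 1 :=
          Real.rpow_le_self_of_one_le (by linarith [n.cast_nonneg (α := ℝ)]) hα1
        calc Real.exp (-n) * (C₀ * (((n : ℝ) + 1) ^ α / a ^ α))
            ≤ Real.exp (-n) * (C₀ * (((n : ℝ) + 1) / a ^ α)) := by gcongr
          _ = _ := by ring
    _ = _ := by
        rw [← ENNReal.ofReal_tsum_of_nonneg (fun n => by positivity)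
          (summable_succ_mul_exp_neg.mul_left _), tsum_mul_left]

/-- The moment transform `h_k` damped by the Gaussian of width `1 / ρ`. -/
noncomputable def dampedFT (μ : Measure ℝ) (k : ℕ) (ρ ξ : ℝ) : ℂ :=
  cexp (-π * (ρ ^ 2 : ℝ) * ξ ^ 2) * momFT1 μ k ξ

theorem norm_gaussian (ρ ξ : ℝ) :
    ‖cexp (-π * (ρ ^ 2 : ℝ) * ξ ^ 2)‖ = Real.exp (-π * (ρ * ξ) ^ 2) := by
  rw [Complex.norm_exp]
  congr 1
  rw [show (-π * (ρ ^ 2 : ℝ) * ξ ^ 2 : ℂ) = ((-π * (ρ * ξ) ^ 2 : ℝ) : ℂ) by push_cast; ring,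
    Complex.ofReal_re]

theorem norm_gaussian_le_one (ρ ξ : ℝ) : ‖cexp (-π * (ρ ^ 2 : ℝ) * ξ ^ 2)‖ ≤ 1 := by
  rw [norm_gaussian, Real.exp_le_one_iff]
  nlinarith [mul_nonneg Real.pi_pos.le (sq_nonneg (ρ * ξ))]

theorem norm_dampedFT_le {μ : Measure ℝ} {k : ℕ} {C : ℝ} (hC : ∀ ξ, ‖momFT1 μ k ξ‖ ≤ C)
    (ρ ξ : ℝ) : ‖dampedFT μ k ρ ξ‖ ≤ C := by
  rw [dampedFT, norm_mul]
  exact (mul_le_of_le_one_left (norm_nonneg _) (norm_gaussian_le_one ρ ξ)).trans (hC ξ)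

theorem integrable_gaussian {ρ : ℝ} (hρ : 0 < ρ) :
    Integrable fun ξ : ℝ => cexp (-π * (ρ ^ 2 : ℝ) * ξ ^ 2) := by
  have := integrable_cexp_neg_mul_sq (b := (π * (ρ ^ 2 : ℝ) : ℂ)) (by
    rw [← Complex.ofReal_mul, Complex.ofReal_re]; positivity)
  simpa [neg_mul] using this

theorem integrable_dampedFT {μ : Measure ℝ} [IsFiniteMeasure μ]
    (hsupp : μ (Set.Icc (0 : ℝ) 1)ᶜ = 0) {k : ℕ} {C : ℝ} (hC : ∀ ξ, ‖momFT1 μ k ξ‖ ≤ C)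
    {ρ : ℝ} (hρ : 0 < ρ) : Integrable (dampedFT μ k ρ) :=
  (integrable_gaussian hρ).mul_bdd (continuous_momFT1 hsupp k).aestronglyMeasurable
    (Filter.Eventually.of_forall hC)

/-- The Fourier transform of the damped moment transform is a Gaussian average of `t ^ k dμ`. -/
theorem fourier_dampedFT {μ : Measure ℝ} [IsFiniteMeasure μ]
    (hsupp : μ (Set.Icc (0 : ℝ) 1)ᶜ = 0) (k : ℕ) {ρ : ℝ} (hρ : 0 < ρ) (v : ℝ) :
    𝓕 (dampedFT μ k ρ) v = ∫ t, (t : ℂ) ^ k *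
      𝓕 (fun ξ : ℝ => cexp (-π * (ρ ^ 2 : ℝ) * ξ ^ 2)) (v + t / (2 * π)) ∂μ := by
  have hpow : Integrable (fun t : ℝ => (t : ℂ) ^ k) μ :=
    Integrable.of_bound (Continuous.aestronglyMeasurable (by fun_prop)) 1
      (ae_norm_pow_le_one hsupp k)
  simp_rw [Real.fourier_real_eq_integral_exp_smul, dampedFT, momFT1, smul_eq_mul,
    ← integral_const_mul]
  rw [integral_integral_swap]
  · refine integral_congr_ae (Filter.Eventually.of_forall fun t => ?_)
    refine integral_congr_ae (Filter.Eventually.of_forall fun ξ => ?_)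
    have hexp : cexp (((-2 * π * ξ * (v + t / (2 * π)) : ℝ) : ℂ) * I) =
        cexp (((-2 * π * ξ * v : ℝ) : ℂ) * I) * cexp (-(I * ξ * t)) := by
      rw [← Complex.exp_add]
      congr 1
      have : (π : ℂ) ≠ 0 := by exact_mod_cast Real.pi_ne_zero
      push_cast
      field_simp
      ring
    simp only [hexp]
    ring
  · have hprod := (integrable_gaussian hρ).mul_prod hpow
    refine (hprod.bdd_mul (c := 1)
      (f := fun z : ℝ × ℝ => cexp (((-2 * π * z.1 * v : ℝ) : ℂ) * I) * cexp (-(I * z.1 * z.2)))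
      (Continuous.aestronglyMeasurable (by fun_prop))
      (Filter.Eventually.of_forall fun z => ?_)).congr
      (Filter.Eventually.of_forall fun z => ?_)
    · rw [norm_mul, Complex.norm_exp_ofReal_mul_I, one_mul, Complex.norm_exp]
      simp
    · simp only [Function.uncurry]
      ring

theorem norm_fourier_dampedFT_le {μ : Measure ℝ} [IsFiniteMeasure μ]
    (hsupp : μ (Set.Icc (0 : ℝ) 1)ᶜ = 0) {α C₀ : ℝ} (hα : 0 < α) (hα1 : α ≤ 1) (hC₀ : 0 < C₀)
    (hfrostman : ∀ x r : ℝ, 0 < r → μ (Set.Icc (x - r) (x + r)) ≤ ENNReal.ofReal (C₀ * r ^ α))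
    (k : ℕ) {ρ : ℝ} (hρ : 0 < ρ) (v : ℝ) :
    ‖𝓕 (dampedFT μ k ρ) v‖ ≤
      4 * (C₀ * ∑' n : ℕ, ((n : ℝ) + 1) * Real.exp (-n)) * ρ ^ (α - 1) := by
  have hS : 0 ≤ ∑' n : ℕ, ((n : ℝ) + 1) * Real.exp (-n) := tsum_nonneg fun n => by positivity
  have hb : 0 < ((ρ ^ 2 : ℝ) : ℂ).re := by rw [Complex.ofReal_re]; positivity
  have hsπ : 0 < √π := Real.sqrt_pos.2 Real.pi_pos
  have hsq : √π ^ 2 = π := Real.sq_sqrt Real.pi_pos.le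
  have hgauss : ∀ t : ℝ, ‖𝓕 (fun ξ : ℝ => cexp (-π * (ρ ^ 2 : ℝ) * ξ ^ 2)) (v + t / (2 * π))‖ =
      ρ⁻¹ * Real.exp (-((2 * √π * ρ)⁻¹ * (t - (-(2 * π * v)))) ^ 2) := by
    intro t
    rw [fourier_gaussian_pi hb]
    simp only
    rw [norm_mul, norm_div, norm_one, Complex.norm_cpow_eq_rpow_re_of_pos (by positivity)]
    congr 1
    · have : (1 / 2 : ℂ).re = 1 / 2 := by norm_num
      rw [this, ← Real.sqrt_eq_rpow, Real.sqrt_sq hρ.le, one_div]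
    · rw [Complex.norm_exp]
      congr 1
      rw [show (-π / (ρ ^ 2 : ℝ) * ((v + t / (2 * π) : ℝ) : ℂ) ^ 2 : ℂ) =
        ((-π / ρ ^ 2 * (v + t / (2 * π)) ^ 2 : ℝ) : ℂ) by push_cast; ring, Complex.ofReal_re]
      have h2 : ((2 * √π * ρ)⁻¹ * (t - (-(2 * π * v)))) ^ 2 =
          (t + 2 * π * v) ^ 2 / (4 * √π ^ 2 * ρ ^ 2) := by
        field_simp
        ring
      rw [h2, hsq]
      field_simp
      ring
  rw [fourier_dampedFT hsupp k hρ]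
  have hint : Integrable (fun t : ℝ =>
      ρ⁻¹ * Real.exp (-((2 * √π * ρ)⁻¹ * (t - (-(2 * π * v)))) ^ 2)) μ := by
    refine (Integrable.of_bound (Continuous.aestronglyMeasurable (by fun_prop)) 1
      (Filter.Eventually.of_forall fun t => ?_)).const_mul _
    rw [Real.norm_eq_abs, Real.abs_exp, Real.exp_le_one_iff]
    nlinarith [sq_nonneg ((2 * √π * ρ)⁻¹ * (t - (-(2 * π * v))))]
  refine (norm_integral_le_of_norm_le hint ?_).trans ?_
  · filter_upwards [ae_norm_pow_le_one hsupp k] with t ht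
    rw [norm_mul, hgauss]
    exact mul_le_of_le_one_left (by positivity) ht
  · rw [integral_const_mul]
    have h1 := integral_gaussian_le_of_frostman hα1 hC₀ hfrostman
      (a := (2 * √π * ρ)⁻¹) (by positivity) (-(2 * π * v))
    have h2 : ((2 * √π * ρ)⁻¹) ^ (-α) ≤ 4 * ρ ^ α := by
      rw [Real.inv_rpow (by positivity), Real.rpow_neg (by positivity), inv_inv,
        Real.mul_rpow (by positivity) hρ.le]
      gcongr
      have h4 : 2 * √π ≤ 4 := by nlinarith [Real.pi_lt_four]
      calc (2 * √π) ^ α ≤ 4 ^ α := by gcongr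
        _ ≤ 4 := Real.rpow_le_self_of_one_le (by norm_num) hα1
    calc _ ≤ ρ⁻¹ * (C₀ * (4 * ρ ^ α) * ∑' n : ℕ, ((n : ℝ) + 1) * Real.exp (-n)) := by
          refine mul_le_mul_of_nonneg_left (h1.trans ?_) (by positivity)
          gcongr
      _ = _ := by
          rw [Real.rpow_sub_one hρ.ne']
          field_simp

end Moments

section Dyadic

open scoped FourierTransform

/-- The pieces of the dyadic Gaussian decomposition of `h_k`. -/
noncomputable def dyadicPiece (μ : Measure ℝ) (k : ℕ) : ℕ → ℝ → ℂ
  | 0, ξ => dampedFT μ k ((1 / 2) ^ 0) ξ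
  | j + 1, ξ => dampedFT μ k ((1 / 2) ^ (j + 1)) ξ - dampedFT μ k ((1 / 2) ^ j) ξ

theorem sum_dyadicPiece (μ : Measure ℝ) (k J : ℕ) (ξ : ℝ) :
    ∑ j ∈ Finset.range (J + 1), dyadicPiece μ k j ξ = dampedFT μ k ((1 / 2) ^ J) ξ := by
  induction J with
  | zero => simp [dyadicPiece]
  | succ J ih => rw [Finset.sum_range_succ, ih, dyadicPiece]; ring

theorem integrable_dyadicPiece {μ : Measure ℝ} [IsFiniteMeasure μ]
    (hsupp : μ (Set.Icc (0 : ℝ) 1)ᶜ = 0) {k : ℕ} {C : ℝ} (hC : ∀ ξ, ‖momFT1 μ k ξ‖ ≤ C) (j : ℕ) :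
    Integrable (dyadicPiece μ k j) := by
  cases j with
  | zero => exact integrable_dampedFT hsupp hC (by positivity)
  | succ j =>
    exact (integrable_dampedFT hsupp hC (by positivity)).sub
      (integrable_dampedFT hsupp hC (by positivity))

/-- A difference of dyadic Gaussians localises to `|ξ| ≳ 1 / ρ`. -/
theorem norm_gaussian_sub_mul_rpow_le {ρ γ : ℝ} (hρ : 0 < ρ) (hγ : 0 < γ) (hγ1 : γ ≤ 1)
    (ξ : ℝ) :
    ‖cexp (-π * (ρ ^ 2 : ℝ) * ξ ^ 2) - cexp (-π * ((2 * ρ) ^ 2 : ℝ) * ξ ^ 2)‖ *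
      (1 + |ξ|) ^ (-γ) ≤ 10 * ρ ^ γ := by
  set u := ρ * |ξ| with hu
  have hu0 : 0 ≤ u := by positivity
  have hu2 : (ρ * ξ) ^ 2 = u ^ 2 := by rw [hu, mul_pow, mul_pow, sq_abs]
  have hreal : cexp (-π * (ρ ^ 2 : ℝ) * ξ ^ 2) - cexp (-π * ((2 * ρ) ^ 2 : ℝ) * ξ ^ 2) =
      ((Real.exp (-(π * u ^ 2)) - Real.exp (-(4 * π * u ^ 2)) : ℝ) : ℂ) := by
    rw [← hu2]
    push_cast
    congr 2 <;> ring
  have hle : Real.exp (-(4 * π * u ^ 2)) ≤ Real.exp (-(π * u ^ 2)) := by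
    apply Real.exp_le_exp.2
    nlinarith [mul_nonneg Real.pi_pos.le (sq_nonneg u)]
  have h1 : Real.exp (-(π * u ^ 2)) ≤ 1 := Real.exp_le_one_iff.2 (by
    nlinarith [mul_nonneg Real.pi_pos.le (sq_nonneg u)])
  rw [hreal, Complex.norm_real, Real.norm_of_nonneg (by linarith)]
  have hξ : u = 0 ∨ 0 < |ξ| := by
    rcases (abs_nonneg ξ).eq_or_lt with h | h
    · left; rw [hu, ← h, mul_zero]
    · exact Or.inr h
  rcases hξ with h0 | hξ
  · rw [h0]; simp; positivity
  have hupos : 0 < u := by positivity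
  have hdec : (1 + |ξ|) ^ (-γ) ≤ ρ ^ γ * u ^ (-γ) := by
    calc (1 + |ξ|) ^ (-γ) ≤ |ξ| ^ (-γ) :=
          Real.rpow_le_rpow_of_nonpos hξ (by linarith) (by linarith)
      _ = ρ ^ γ * u ^ (-γ) := by
          rw [hu, Real.mul_rpow hρ.le hξ.le, ← mul_assoc, ← Real.rpow_add hρ, add_neg_cancel,
            Real.rpow_zero, one_mul]
  have hργ : 0 < ρ ^ γ := by positivity
  rcases le_total 1 u with hu1 | hu1
  · have h2 : u ^ (-γ) ≤ 1 := Real.rpow_le_one_of_one_le_of_nonpos hu1 (by linarith)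
    have h3 : Real.exp (-(π * u ^ 2)) - Real.exp (-(4 * π * u ^ 2)) ≤ 1 := by
      linarith [Real.exp_pos (-(4 * π * u ^ 2))]
    calc _ ≤ 1 * (ρ ^ γ * u ^ (-γ)) := by gcongr
      _ ≤ 1 * (ρ ^ γ * 1) := by gcongr
      _ ≤ _ := by linarith
  · have h3 : Real.exp (-(π * u ^ 2)) - Real.exp (-(4 * π * u ^ 2)) ≤ 3 * π * u ^ 2 := by
      have e : Real.exp (-(4 * π * u ^ 2)) =
          Real.exp (-(π * u ^ 2)) * Real.exp (-(3 * π * u ^ 2)) := by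
        rw [← Real.exp_add]; congr 1; ring
      have := Real.add_one_le_exp (-(3 * π * u ^ 2))
      rw [e]
      nlinarith [Real.exp_pos (-(π * u ^ 2)), mul_nonneg Real.pi_pos.le (sq_nonneg u)]
    have h4 : u ^ 2 * u ^ (-γ) ≤ 1 := by
      rw [← Real.rpow_natCast, ← Real.rpow_add hupos]
      exact Real.rpow_le_one hu0 hu1 (by push_cast; linarith)
    calc _ ≤ 3 * π * u ^ 2 * (ρ ^ γ * u ^ (-γ)) := by gcongr
      _ = 3 * π * ρ ^ γ * (u ^ 2 * u ^ (-γ)) := by ring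
      _ ≤ 3 * π * ρ ^ γ * 1 := by gcongr
      _ ≤ _ := by nlinarith [Real.pi_lt_d2]

theorem norm_dyadicPiece_le {μ : Measure ℝ} {k : ℕ} {C γ : ℝ} (hC : 0 < C) (hγ : 0 < γ)
    (hγ1 : γ ≤ 1) (hdecay : ∀ ξ, ‖momFT1 μ k ξ‖ ≤ C * (1 + |ξ|) ^ (-γ)) (j : ℕ) (ξ : ℝ) :
    ‖dyadicPiece μ k j ξ‖ ≤ 10 * C * ((1 / 2 : ℝ) ^ j) ^ γ := by
  cases j with
  | zero =>
    have hbound : ∀ ξ, ‖momFT1 μ k ξ‖ ≤ C := fun ξ => (hdecay ξ).trans <|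
      mul_le_of_le_one_right hC.le <|
        Real.rpow_le_one_of_one_le_of_nonpos (by linarith [abs_nonneg ξ]) (by linarith)
    rw [dyadicPiece, pow_zero, Real.one_rpow]
    linarith [norm_dampedFT_le hbound 1 ξ]
  | succ j =>
    have e : ((1 / 2 : ℝ) ^ j) = 2 * (1 / 2 : ℝ) ^ (j + 1) := by rw [pow_succ]; ring
    rw [dyadicPiece, dampedFT, dampedFT, ← sub_mul, norm_mul, e]
    have := norm_gaussian_sub_mul_rpow_le (ρ := (1 / 2 : ℝ) ^ (j + 1)) (by positivity) hγ hγ1 ξ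
    calc _ ≤ _ * (C * (1 + |ξ|) ^ (-γ)) := by gcongr; exact hdecay ξ
      _ = C * (_ * (1 + |ξ|) ^ (-γ)) := by ring
      _ ≤ C * (10 * ((1 / 2 : ℝ) ^ (j + 1)) ^ γ) := by gcongr
      _ = _ := by ring

theorem norm_fourier_dyadicPiece_le {μ : Measure ℝ} [IsFiniteMeasure μ]
    (hsupp : μ (Set.Icc (0 : ℝ) 1)ᶜ = 0) {α C₀ C : ℝ} (hα : 0 < α) (hα1 : α ≤ 1) (hC₀ : 0 < C₀)
    (hfrostman : ∀ x r : ℝ, 0 < r → μ (Set.Icc (x - r) (x + r)) ≤ ENNReal.ofReal (C₀ * r ^ α))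
    {k : ℕ} (hC : ∀ ξ, ‖momFT1 μ k ξ‖ ≤ C) (j : ℕ) (v : ℝ) :
    ‖𝓕 (dyadicPiece μ k j) v‖ ≤
      8 * (C₀ * ∑' n : ℕ, ((n : ℝ) + 1) * Real.exp (-n)) * ((1 / 2 : ℝ) ^ j) ^ (α - 1) := by
  have hS : 0 ≤ ∑' n : ℕ, ((n : ℝ) + 1) * Real.exp (-n) := tsum_nonneg fun n => by positivity
  have hbd := fun i : ℕ => norm_fourier_dampedFT_le hsupp hα hα1 hC₀ hfrostman k
    (ρ := (1 / 2 : ℝ) ^ i) (by positivity) v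
  set E := C₀ * ∑' n : ℕ, ((n : ℝ) + 1) * Real.exp (-n)
  have hE : 0 ≤ E := by positivity
  have hnn : ∀ i : ℕ, 0 ≤ E * ((1 / 2 : ℝ) ^ i) ^ (α - 1) := fun i => by positivity
  cases j with
  | zero =>
    have : dyadicPiece μ k 0 = dampedFT μ k ((1 / 2) ^ 0) := by ext ξ; rw [dyadicPiece]
    rw [this]
    linarith [hbd 0, hnn 0]
  | succ j =>
    have hint := fun i : ℕ => integrable_dampedFT hsupp hC (ρ := (1 / 2 : ℝ) ^ i) (by positivity)
    have hsub : 𝓕 (dyadicPiece μ k (j + 1)) v =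
        𝓕 (dampedFT μ k ((1 / 2) ^ (j + 1))) v - 𝓕 (dampedFT μ k ((1 / 2) ^ j)) v := by
      simp_rw [Real.fourier_eq]
      rw [← integral_sub ((Real.fourierIntegral_convergent_iff v).2 (hint _))
        ((Real.fourierIntegral_convergent_iff v).2 (hint _))]
      simp_rw [← smul_sub, dyadicPiece]
    have hmono : ((1 / 2 : ℝ) ^ j) ^ (α - 1) ≤ ((1 / 2 : ℝ) ^ (j + 1)) ^ (α - 1) :=
      Real.rpow_le_rpow_of_nonpos (by positivity)
        (pow_le_pow_of_le_one (by norm_num) (by norm_num) (Nat.le_succ j)) (by linarith)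
    rw [hsub]
    have := mul_le_mul_of_nonneg_left hmono hE
    linarith [norm_sub_le (𝓕 (dampedFT μ k ((1 / 2) ^ (j + 1))) v)
      (𝓕 (dampedFT μ k ((1 / 2) ^ j)) v), hbd j, hbd (j + 1)]

end Dyadic

section Convolution

open scoped FourierTransform

/-- `L^p → L^q` bound for convolution with a kernel `K` with `‖K‖_∞ ≤ A` and `‖𝓕 K‖_∞ ≤ B`. -/
theorem eLpNorm_convolution_le {K : ℝ → ℂ} {A B p q : ℝ} (hA0 : 0 < A) (hB0 : 0 < B)
    (hpq : p.HolderConjugate q) (hp2 : p < 2) (hK : Integrable K)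
    (hA : ∀ x, ‖K x‖ ≤ A) (hB : ∀ v, ‖𝓕 K v‖ ≤ B) (f : SchwartzMap ℝ ℂ) :
    eLpNorm (fun x => ∫ y, f (x - y) * K y) (ENNReal.ofReal q) volume ≤
      ENNReal.ofReal (2 * (q / (q - 2)) ^ (1 / q) * (A ^ (q - 2) * B ^ 2) ^ (1 / q)) *
        eLpNorm f (ENNReal.ofReal p) volume := by
  refine eLpNorm_le_of_bound_one_two (T := fun g x => ∫ y, g (x - y) * K y) hA0 hB0 hpq hp2
    (fun g₁ g₂ h₁ h₂ x => ?_) (fun g hg => aestronglyMeasurable_integral_comp_sub_mul hg hK)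
    (fun g hg x => norm_integral_comp_sub_mul_le hg hA x)
    (fun g hg hg2 => eLpNorm_two_convolution_le hK hA hB hg hg2)
    f.continuous.measurable f.integrable (f.memLp 2) (f.memLp _)
  rw [← integral_add (integrable_comp_sub_mul h₁ hK.aestronglyMeasurable hA x)
    (integrable_comp_sub_mul h₂ hK.aestronglyMeasurable hA x)]
  simp [add_mul]

end Convolution

section Summation

/-- Summing the dyadic pieces: a bound for convolution with `h_k`, uniform in `k`. -/
theorem exists_eLpNorm_convolution_momFT1_le (μ : Measure ℝ) [IsFiniteMeasure μ]
    (hsupp : μ (Set.Icc (0 : ℝ) 1)ᶜ = 0) {α γ : ℝ} (hα : 0 < α) (hα1 : α ≤ 1) (hγ : 0 < γ)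
    (hγ1 : γ ≤ 1) {C₀ C₁ : ℝ} (hC₀ : 0 < C₀) (hC₁ : 0 < C₁)
    (hfrostman : ∀ x r : ℝ, 0 < r → μ (Set.Icc (x - r) (x + r)) ≤ ENNReal.ofReal (C₀ * r ^ α))
    (hdecay : ∀ (k : ℕ) (ξ : ℝ), ‖momFT1 μ k ξ‖ ≤ C₁ * (1 + |ξ|) ^ (-γ))
    {p q : ℝ} (hpq : p.HolderConjugate q) (hp2 : p < 2) (he : 2 * (1 - α) < γ * (q - 2)) :
    ∃ C > (0 : ℝ), ∀ (k : ℕ) (f : SchwartzMap ℝ ℂ),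
      eLpNorm (fun x => ∫ y, f (x - y) * momFT1 μ k y) (ENNReal.ofReal q) volume ≤
        ENNReal.ofReal C * eLpNorm (⇑f) (ENNReal.ofReal p) volume := by
  have hq0 : 0 < q := hpq.symm.pos
  have hq1 : 1 < q := hpq.symm.lt
  have hq2 : 0 < q - 2 := by nlinarith [hpq.mul_eq_add]
  set S := ∑' n : ℕ, ((n : ℝ) + 1) * Real.exp (-n) with hSdef
  have hS : 0 < S := summable_succ_mul_exp_neg.tsum_pos (fun n => by positivity) 0 (by positivity)
  set E := (10 * C₁) ^ (q - 2) * (8 * (C₀ * S)) ^ 2 with hE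
  set e := γ * (q - 2) + (α - 1) * 2 with hedef
  have he0 : 0 < e := by rw [hedef]; linarith
  set r := ((1 / 2 : ℝ) ^ e) ^ (1 / q) with hr
  have hr0 : 0 ≤ r := by positivity
  have hr1 : r < 1 := by
    refine Real.rpow_lt_one (by positivity) ?_ (by positivity)
    exact Real.rpow_lt_one (by norm_num) (by norm_num) he0
  set c := 2 * (q / (q - 2)) ^ (1 / q) * E ^ (1 / q) with hc
  have hc0 : 0 < c := by positivity
  have hbound : ∀ k ξ, ‖momFT1 μ k ξ‖ ≤ C₁ := fun k ξ => (hdecay k ξ).trans <|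
    mul_le_of_le_one_right hC₁.le <|
      Real.rpow_le_one_of_one_le_of_nonpos (by linarith [abs_nonneg ξ]) (by linarith)
  refine ⟨c * (1 - r)⁻¹, mul_pos hc0 (inv_pos.2 (by linarith)), fun k f => ?_⟩
  have hpiece : ∀ j : ℕ,
      eLpNorm (fun x => ∫ y, f (x - y) * dyadicPiece μ k j y) (ENNReal.ofReal q) volume ≤
        ENNReal.ofReal (c * r ^ j) * eLpNorm f (ENNReal.ofReal p) volume := by
    intro j
    have hρ : 0 < (1 / 2 : ℝ) ^ j := by positivity
    refine (eLpNorm_convolution_le (A := 10 * C₁ * ((1 / 2 : ℝ) ^ j) ^ γ)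
      (B := 8 * (C₀ * S) * ((1 / 2 : ℝ) ^ j) ^ (α - 1)) (by positivity) (by positivity) hpq hp2
      (integrable_dyadicPiece hsupp (hbound k) j)
      (norm_dyadicPiece_le hC₁ hγ hγ1 (hdecay k) j)
      (norm_fourier_dyadicPiece_le hsupp hα hα1 hC₀ hfrostman (hbound k) j) f).trans_eq ?_
    congr 2
    have h1 : (10 * C₁ * ((1 / 2 : ℝ) ^ j) ^ γ) ^ (q - 2) *
        (8 * (C₀ * S) * ((1 / 2 : ℝ) ^ j) ^ (α - 1)) ^ 2 = E * ((1 / 2 : ℝ) ^ j) ^ e := by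
      rw [Real.mul_rpow (by positivity) (by positivity), mul_pow, ← Real.rpow_mul hρ.le,
        ← Real.rpow_mul_natCast hρ.le, hedef, Real.rpow_add hρ, hE]
      push_cast
      ring
    have h2 : (((1 / 2 : ℝ) ^ j) ^ e) ^ (1 / q) = r ^ j := by
      rw [hr, ← Real.rpow_natCast, ← Real.rpow_natCast, ← Real.rpow_mul (by positivity),
        ← Real.rpow_mul (by positivity), ← Real.rpow_mul (by positivity),
        ← Real.rpow_mul (by positivity)]
      congr 1
      ring
    rw [h1, Real.mul_rpow (by positivity) (by positivity), h2, hc]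
    ring
  have hpieceInt := fun j => integrable_dyadicPiece hsupp (hbound k) j
  have hmeas := fun j => aestronglyMeasurable_integral_comp_sub_mul f.integrable (hpieceInt j)
  have hsum : ∀ J : ℕ, (fun x => ∫ y, f (x - y) * dampedFT μ k ((1 / 2) ^ J) y) =
      ∑ j ∈ Finset.range (J + 1), fun x => ∫ y, f (x - y) * dyadicPiece μ k j y := by
    intro J
    ext x
    rw [Finset.sum_apply, ← integral_finsetSum _ fun j _ =>
      integrable_comp_sub_mul f.integrable (hpieceInt j).aestronglyMeasurable
        (norm_dyadicPiece_le hC₁ hγ hγ1 (hdecay k) j) x]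
    simp_rw [← Finset.mul_sum, sum_dyadicPiece]
  have hpartial : ∀ J : ℕ,
      eLpNorm (fun x => ∫ y, f (x - y) * dampedFT μ k ((1 / 2) ^ J) y) (ENNReal.ofReal q) volume ≤
        ENNReal.ofReal (c * (1 - r)⁻¹) * eLpNorm f (ENNReal.ofReal p) volume := by
    intro J
    rw [hsum]
    calc _ ≤ ∑ j ∈ Finset.range (J + 1),
            eLpNorm (fun x => ∫ y, f (x - y) * dyadicPiece μ k j y) (ENNReal.ofReal q) volume :=
          eLpNorm_sum_le (fun j _ => hmeas j) (ENNReal.one_le_ofReal.2 hq1.le)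
      _ ≤ ∑ j ∈ Finset.range (J + 1),
            ENNReal.ofReal (c * r ^ j) * eLpNorm f (ENNReal.ofReal p) volume :=
          Finset.sum_le_sum fun j _ => hpiece j
      _ ≤ _ := by
          rw [← Finset.sum_mul, ← ENNReal.ofReal_sum_of_nonneg fun j _ => by positivity]
          gcongr
          rw [← Finset.mul_sum, ← tsum_geometric_of_lt_one hr0 hr1]
          gcongr
          exact (summable_geometric_of_lt_one hr0 hr1).sum_le_tsum _ fun j _ => by positivity
  have hlim : ∀ x, Filter.Tendsto (fun J : ℕ => ∫ y, f (x - y) * dampedFT μ k ((1 / 2) ^ J) y)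
      Filter.atTop (nhds (∫ y, f (x - y) * momFT1 μ k y)) := by
    intro x
    refine tendsto_integral_of_dominated_convergence (fun y => ‖f (x - y)‖ * C₁)
      (fun J => (integrable_comp_sub_mul f.integrable
        (integrable_dampedFT hsupp (hbound k) (by positivity)).aestronglyMeasurable
        (A := C₁) (fun ξ => ?_) x).aestronglyMeasurable)
      ((f.integrable.comp_sub_left x).norm.mul_const C₁)
      (fun J => Filter.Eventually.of_forall fun y => ?_)
      (Filter.Eventually.of_forall fun y => ?_)
    · exact norm_dampedFT_le (hbound k) _ ξ
    · rw [norm_mul]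
      gcongr
      exact norm_dampedFT_le (hbound k) _ y
    · have hpow : Filter.Tendsto (fun J : ℕ => (1 / 2 : ℝ) ^ J) Filter.atTop (nhds 0) :=
        tendsto_pow_atTop_nhds_zero_of_lt_one (by norm_num) (by norm_num)
      have hcont : Continuous fun ρ : ℝ => f (x - y) * dampedFT μ k ρ y := by
        unfold dampedFT
        fun_prop
      have := (hcont.tendsto 0).comp hpow
      simpa [dampedFT, Function.comp_def] using this
  refine (Lp.eLpNorm_lim_le_liminf_eLpNorm (fun J => ?_) _
    (Filter.Eventually.of_forall hlim)).trans ?_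
  · rw [hsum]
    exact Finset.aestronglyMeasurable_sum _ fun j _ => hmeas j
  · exact Filter.liminf_le_of_le (by isBoundedDefault) fun b hb =>
      let ⟨J, hJ⟩ := hb.exists
      hJ.trans (hpartial J)

end Summation

/-- A measure on `[0,1]` with Frostman exponent `α` all of whose moments have
Fourier decay of order `β/2` satisfies the `L^p`-`L²` restriction problem with moments, in the
equivalent convolution (Tomas–Stein/Mockenhaupt) form, for
`1 ≤ p < 2(2-2α+β)/(4(1-α)+β)`. -/
theorem stmt19 (μ : Measure ℝ) [IsFiniteMeasure μ] (hsupp : μ (Set.Icc (0 : ℝ) 1)ᶜ = 0)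
    (α β : ℝ) (hα : 0 < α) (hα1 : α ≤ 1) (hβ : 0 < β) (hβ1 : β ≤ 1)
    (C₀ C₁ : ℝ) (hC₀ : 0 < C₀) (hC₁ : 0 < C₁)
    (hfrostman : ∀ x r : ℝ, 0 < r → μ (Set.Icc (x - r) (x + r)) ≤ ENNReal.ofReal (C₀ * r ^ α))
    (hdecay : ∀ (k : ℕ) (ξ : ℝ), ‖momFT1 μ k ξ‖ ≤ C₁ * (1 + |ξ|) ^ (-(β / 2)))
    (p : ℝ) (hp1 : 1 ≤ p) (hp2 : p < 2 * (2 - 2 * α + β) / (4 * (1 - α) + β))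
    (p' : ENNReal) (hp' : 1 / ENNReal.ofReal p + 1 / p' = 1) :
    ∃ C > (0 : ℝ), ∀ (k : ℕ) (f : SchwartzMap ℝ ℂ),
      eLpNorm (fun x => ∫ y, f (x - y) * momFT1 μ k y) p' volume ≤
        ENNReal.ofReal (C * (eLpNorm (⇑f) (ENNReal.ofReal p) volume).toReal) := by
  suffices h : ∃ C > (0 : ℝ), ∀ (k : ℕ) (f : SchwartzMap ℝ ℂ),
      eLpNorm (fun x => ∫ y, f (x - y) * momFT1 μ k y) p' volume ≤
        ENNReal.ofReal C * eLpNorm (⇑f) (ENNReal.ofReal p) volume by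
    obtain ⟨C, hC, h⟩ := h
    refine ⟨C, hC, fun k f => ?_⟩
    rw [ENNReal.ofReal_mul hC.le, ENNReal.ofReal_toReal (f.memLp _ volume).eLpNorm_ne_top]
    exact h k f
  rcases hp1.eq_or_lt with rfl | hp1
  · have hp'top : p' = ⊤ := by
      rw [ENNReal.ofReal_one, div_one] at hp'
      simpa using (ENNReal.add_right_inj ENNReal.one_ne_top).1 (hp'.trans (add_zero 1).symm)
    refine ⟨C₁, hC₁, fun k f => ?_⟩
    have hbound : ∀ ξ, ‖momFT1 μ k ξ‖ ≤ C₁ := fun ξ => (hdecay k ξ).trans <|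
      mul_le_of_le_one_right hC₁.le <|
        Real.rpow_le_one_of_one_le_of_nonpos (by linarith [abs_nonneg ξ]) (by linarith)
    rw [hp'top, ENNReal.ofReal_one, eLpNorm_exponent_top, eLpNorm_one_eq_lintegral_enorm,
      ← ofReal_integral_norm_eq_lintegral_enorm f.integrable, ← ENNReal.ofReal_mul hC₁.le]
    exact eLpNormEssSup_le_of_ae_bound (Filter.Eventually.of_forall
      (norm_integral_comp_sub_mul_le f.integrable hbound))
  · have hpq : p.HolderConjugate (p / (p - 1)) := Real.HolderConjugate.conjExponent hp1
    have hp1' : 0 < p - 1 := by linarith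
    have hden : 0 < 4 * (1 - α) + β := by linarith
    rw [lt_div_iff₀ hden] at hp2
    have hp2' : p < 2 := by nlinarith
    have hp'q : p' = ENNReal.ofReal (p / (p - 1)) := by
      have h1 : 1 / ENNReal.ofReal p + 1 / ENNReal.ofReal (p / (p - 1)) = 1 := by
        rw [one_div, one_div, ← ENNReal.ofReal_inv_of_pos hpq.pos,
          ← ENNReal.ofReal_inv_of_pos hpq.symm.pos,
          ← ENNReal.ofReal_add hpq.inv_nonneg hpq.symm.inv_nonneg, hpq.inv_add_inv_eq_one,
          ENNReal.ofReal_one]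
      have h2 : 1 / ENNReal.ofReal p ≠ ⊤ := by simp; linarith
      have h3 := (ENNReal.add_right_inj h2).1 (hp'.trans h1.symm)
      simpa using h3
    rw [hp'q]
    refine exists_eLpNorm_convolution_momFT1_le μ hsupp hα hα1 (half_pos hβ) (by linarith) hC₀ hC₁
      hfrostman hdecay hpq hp2' ?_
    have h4 : p / (p - 1) - 2 = (2 - p) / (p - 1) := by field_simp; ring
    rw [h4, ← mul_div_assoc, lt_div_iff₀ hp1']
    nlinarith
end
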